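/- arXiv:2006.02892 — 6 statements merged into one kernel-verified Lean document; each statement's English description precedes it below -/
import Mathlib

section
/- Let T be an integrally closed (normal) integral domain, A a subring of T, and V a non-empty subset of T with 0 ∉ V such that T = A[V]. Set R = A[{fg : f, g ∈ V} ∪ {f³ : f ∈ V}]. Then T is the integral closure of R in its field of fractions (so Q(R) = Q(T) and T = R̄), R is strictly closed, and hence R is a weakly Arf ring. -/
open scoped TensorProduct

/-- `R` is a weakly Arf ring. -/
def IsWeaklyArf (R : Type*) [CommRing R] : Prop :=
  ∀ x y z : R, x ∈ nonZeroDivisors R →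
    (∃ u ∈ integralClosure R (FractionRing R),
        u * algebraMap R (FractionRing R) x = algebraMap R (FractionRing R) y) →
    (∃ v ∈ integralClosure R (FractionRing R),
        v * algebraMap R (FractionRing R) x = algebraMap R (FractionRing R) z) →
    ∃ r : R, algebraMap R (FractionRing R) r * algebraMap R (FractionRing R) x
        = algebraMap R (FractionRing R) (y * z)

/-- `R` is strictly closed in the `R`-algebra `S`. -/
def IsStrictlyClosedIn (R S : Type*) [CommRing R] [CommRing S] [Algebra R S] : Prop :=
  ∀ s : S, s ⊗ₜ[R] (1 : S) = (1 : S) ⊗ₜ[R] s → s ∈ (algebraMap R S).range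

/-- `R` is strictly closed (in the integral closure `R̄` of `R` in `Q(R)`). -/
def IsStrictlyClosed (R : Type*) [CommRing R] : Prop :=
  IsStrictlyClosedIn R (integralClosure R (FractionRing R))

/-- The subring `R = A[{fg : f, g ∈ V} ∪ {f³ : f ∈ V}]` of `T`. -/
def cubesAndProductsAdjoin {T : Type*} [CommRing T] (A : Subring T) (V : Set T) : Subring T :=
  Subring.closure ((A : Set T) ∪ {x | ∃ f ∈ V, ∃ g ∈ V, x = f * g} ∪ {x | ∃ f ∈ V, x = f ^ 3})

/-- Tensor criterion: if `S = R + M` with `M * M ⊆ R`, then `R` is strictly closed in `S`. -/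
theorem strictlyClosedIn_of_sq (R S : Type*) [CommRing R] [CommRing S] [Algebra R S]
    (M : Submodule R S)
    (hMM : ∀ m ∈ M, ∀ n ∈ M, ∃ r : R, algebraMap R S r = m * n)
    (hdec : ∀ t : S, ∃ r : R, t - algebraMap R S r ∈ M) :
    IsStrictlyClosedIn R S := by
  intro s hs
  choose ρ hρ using hdec
  let N : Submodule R S := (1 : Submodule R S)
  have hN : ∀ x, x ∈ N ↔ ∃ r : R, algebraMap R S r = x := fun x => Submodule.mem_one
  have key : ∀ c : R, algebraMap R S c ∈ M → ∀ x : S, c • x ∈ N := by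
    intro c hc x
    obtain ⟨r, hr⟩ := hMM _ hc _ (hρ x)
    rw [hN]
    refine ⟨c * ρ x + r, ?_⟩
    rw [map_add, hr, map_mul, Algebra.smul_def]
    ring
  have key2 : ∀ c d : R, algebraMap R S c - algebraMap R S d ∈ M → ∀ x : S,
      N.mkQ (c • x) = N.mkQ (d • x) := by
    intro c d h x
    rw [← sub_eq_zero, ← map_sub, ← sub_smul, Submodule.mkQ_apply, Submodule.Quotient.mk_eq_zero]
    apply key
    rwa [map_sub]
  let B : S →ₗ[R] S →ₗ[R] (S ⧸ N) := LinearMap.mk₂ R (fun t x => N.mkQ (ρ t • x))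
    (by
      intro t t' x
      rw [← map_add, ← add_smul]
      apply key2
      rw [map_add]
      have := M.sub_mem (M.add_mem (hρ t) (hρ t')) (hρ (t + t'))
      convert this using 1
      ring)
    (by
      intro c t x
      rw [← map_smul, smul_smul]
      apply key2
      have := M.sub_mem (M.smul_mem c (hρ t)) (hρ (c • t))
      convert this using 1
      rw [map_mul, smul_sub, Algebra.smul_def c (algebraMap R S (ρ t))]
      ring)
    (by intro t x x'; rw [smul_add, map_add])
    (by intro c t x; rw [smul_comm, map_smul])
  have h := congrArg (TensorProduct.lift B) hs
  simp only [TensorProduct.lift.tmul] at h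
  have h1 : B s 1 = 0 := by
    change N.mkQ (ρ s • (1 : S)) = 0
    rw [Submodule.mkQ_apply, Submodule.Quotient.mk_eq_zero, hN]
    exact ⟨ρ s, by rw [Algebra.smul_def, mul_one]⟩
  have h2 : B 1 s = N.mkQ s := by
    change N.mkQ (ρ 1 • s) = N.mkQ s
    conv_rhs => rw [← one_smul R s]
    apply key2
    have := M.neg_mem (hρ 1)
    rw [map_one]
    convert this using 1
    ring
  rw [h1, h2] at h
  have h3 : s ∈ N := by
    rw [← Submodule.Quotient.mk_eq_zero]
    exact h.symm
  obtain ⟨r, hr⟩ := (hN s).1 h3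
  exact ⟨r, hr⟩

/-- Strict closedness is invariant under algebra isomorphism. -/
theorem strictlyClosedIn_congr {R S S' : Type*} [CommRing R] [CommRing S] [CommRing S']
    [Algebra R S] [Algebra R S'] (e : S ≃ₐ[R] S') (h : IsStrictlyClosedIn R S) :
    IsStrictlyClosedIn R S' := by
  intro s hs
  have h1 := congrArg (TensorProduct.map e.symm.toLinearMap e.symm.toLinearMap) hs
  simp only [TensorProduct.map_tmul, AlgEquiv.toLinearMap_apply, map_one] at h1
  obtain ⟨r, hr⟩ := h _ h1
  refine ⟨r, ?_⟩
  apply e.symm.injective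
  rw [← hr, AlgEquiv.commutes]

/-- Strictly closed rings are weakly Arf. -/
theorem weaklyArf_of_strictlyClosed {R : Type*} [CommRing R] (h : IsStrictlyClosed R) :
    IsWeaklyArf R := by
  rintro x y z - ⟨u, hu, hux⟩ ⟨v, hv, hvx⟩
  let S := integralClosure R (FractionRing R)
  let u' : S := ⟨u, hu⟩
  let v' : S := ⟨v, hv⟩
  have e1 : x • u' = y • (1 : S) := by
    apply Subtype.ext
    change x • u = y • (1 : FractionRing R)
    rw [Algebra.smul_def, Algebra.smul_def, mul_one, ← hux, mul_comm]
  have e2 : x • v' = z • (1 : S) := by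
    apply Subtype.ext
    change x • v = z • (1 : FractionRing R)
    rw [Algebra.smul_def, Algebra.smul_def, mul_one, ← hvx, mul_comm]
  have e3 : z • u' = y • v' := by
    apply Subtype.ext
    change z • u = y • v
    rw [Algebra.smul_def, Algebra.smul_def, ← hvx, ← hux]
    ring
  obtain ⟨r, hr⟩ := h (y • v') (by
    calc (y • v') ⊗ₜ[R] (1 : S) = v' ⊗ₜ[R] (y • (1 : S)) := TensorProduct.smul_tmul _ _ _
      _ = v' ⊗ₜ[R] (x • u') := by rw [e1]
      _ = (x • v') ⊗ₜ[R] u' := (TensorProduct.smul_tmul _ _ _).symm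
      _ = (z • (1 : S)) ⊗ₜ[R] u' := by rw [e2]
      _ = (1 : S) ⊗ₜ[R] (z • u') := TensorProduct.smul_tmul _ _ _
      _ = (1 : S) ⊗ₜ[R] (y • v') := by rw [e3])
  refine ⟨r, ?_⟩
  have hr' : algebraMap R (FractionRing R) r = y • v := congrArg Subtype.val hr
  rw [hr', Algebra.smul_def, map_mul, mul_assoc, hvx]

/-- The abstract form of the main theorem. -/
theorem strictlyClosed_aux (R T K : Type*) [CommRing R] [IsDomain R] [CommRing T] [IsDomain T]
    [IsIntegrallyClosed T] [Field K] [Algebra T K] [IsFractionRing T K]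
    [Algebra R T] [Algebra R K] [IsScalarTower R T K]
    (hinj : Function.Injective (algebraMap R T)) (V : Set T) (hVne : V.Nonempty)
    (h0 : (0 : T) ∉ V)
    (hmul : ∀ f ∈ V, ∀ g ∈ V, ∃ r : R, algebraMap R T r = f * g)
    (hcube : ∀ f ∈ V, ∃ r : R, algebraMap R T r = f ^ 3)
    (A : Subring T) (hA : ∀ a ∈ A, ∃ r : R, algebraMap R T r = a)
    (hgen : Subring.closure ((A : Set T) ∪ V) = ⊤) :
    (IsFractionRing R K ∧
      (integralClosure R K : Set K) = Set.range (algebraMap T K)) ∧ IsStrictlyClosed R := by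
  let M : Submodule R T := Submodule.span R V
  have hMM : ∀ m ∈ M, ∀ n ∈ M, ∃ r : R, algebraMap R T r = m * n := by
    have : M * M ≤ 1 := by
      rw [Submodule.span_mul_span, Submodule.span_le]
      rintro _ ⟨f, hf, g, hg, rfl⟩
      exact Submodule.mem_one.2 (hmul f hf g hg)
    intro m hm n hn
    exact Submodule.mem_one.1 (this (Submodule.mul_mem_mul hm hn))
  have hdec : ∀ t : T, ∃ r : R, t - algebraMap R T r ∈ M := by
    intro t
    have ht : t ∈ Subring.closure ((A : Set T) ∪ V) := by rw [hgen]; trivial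
    induction ht using Subring.closure_induction with
    | mem x hx =>
      rcases hx with hx | hx
      · obtain ⟨r, hr⟩ := hA x hx
        exact ⟨r, by rw [hr, sub_self]; exact M.zero_mem⟩
      · exact ⟨0, by rw [map_zero, sub_zero]; exact Submodule.subset_span hx⟩
    | zero => exact ⟨0, by rw [map_zero, sub_zero]; exact M.zero_mem⟩
    | one => exact ⟨1, by rw [map_one, sub_self]; exact M.zero_mem⟩
    | add x y _ _ hx hy =>
      obtain ⟨r, hr⟩ := hx
      obtain ⟨s, hs⟩ := hy
      refine ⟨r + s, ?_⟩
      convert M.add_mem hr hs using 1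
      rw [map_add]; ring
    | neg x _ hx =>
      obtain ⟨r, hr⟩ := hx
      refine ⟨-r, ?_⟩
      convert M.neg_mem hr using 1
      rw [map_neg]; ring
    | mul x y _ _ hx hy =>
      obtain ⟨r, hr⟩ := hx
      obtain ⟨s, hs⟩ := hy
      obtain ⟨c, hc⟩ := hMM _ hr _ hs
      refine ⟨r * s + c, ?_⟩
      convert M.add_mem (M.smul_mem r hs) (M.smul_mem s hr) using 1
      rw [map_add, hc, map_mul, Algebra.smul_def, Algebra.smul_def]; ring
  have hintegral : ∀ t : T, IsIntegral R t := by
    intro t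
    obtain ⟨r, hr⟩ := hdec t
    obtain ⟨c, hc⟩ := hMM _ hr _ hr
    have h1 : IsIntegral R (t - algebraMap R T r) := by
      apply IsIntegral.of_pow (n := 2) (by norm_num)
      rw [pow_two, ← hc]
      exact isIntegral_algebraMap
    have := h1.add (isIntegral_algebraMap (x := r))
    simpa using this
  obtain ⟨f, hf⟩ := hVne
  have hf0 : f ≠ 0 := fun h => h0 (h ▸ hf)
  obtain ⟨d, hd⟩ := hcube f hf
  obtain ⟨q, hq⟩ := hmul f hf f hf
  have hd0 : d ≠ 0 := by
    rintro rfl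
    rw [map_zero] at hd
    exact pow_ne_zero 3 hf0 hd.symm
  have hcond : ∀ t : T, ∃ r : R, algebraMap R T r = f ^ 3 * t := by
    intro t
    obtain ⟨r, hr⟩ := hdec t
    obtain ⟨c, hc⟩ := hMM f (Submodule.subset_span hf) _ hr
    refine ⟨d * r + q * c, ?_⟩
    rw [map_add, map_mul, map_mul, hd, hq, hc]; ring
  have hTK : Function.Injective (algebraMap T K) := IsFractionRing.injective T K
  have hRK : Function.Injective (algebraMap R K) := by
    rw [IsScalarTower.algebraMap_eq R T K]
    exact hTK.comp hinj
  haveI hfr : IsFractionRing R K := by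
    haveI : FaithfulSMul R K := (faithfulSMul_iff_algebraMap_injective R K).2 hRK
    refine IsFractionRing.of_field R K ?_
    intro z
    obtain ⟨a, b, hb, rfl⟩ := IsFractionRing.div_surjective (A := T) z
    obtain ⟨r, hr⟩ := hcond a
    obtain ⟨s, hs⟩ := hcond b
    have hb0 : algebraMap T K b ≠ 0 := by
      rw [Ne, map_eq_zero_iff _ hTK]
      exact nonZeroDivisors.ne_zero hb
    have hfK : algebraMap T K f ≠ 0 := by
      rwa [Ne, map_eq_zero_iff _ hTK]
    refine ⟨r, s, ?_⟩
    rw [IsScalarTower.algebraMap_apply R T K, IsScalarTower.algebraMap_apply R T K, hr, hs,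
      map_mul, map_mul, map_pow]
    field_simp
  haveI hic : IsIntegralClosure T R K := by
    refine ⟨hTK, ?_⟩
    intro x
    constructor
    · intro hx
      have : IsIntegral T x := hx.tower_top
      exact IsIntegrallyClosed.isIntegral_iff.1 this
    · rintro ⟨y, rfl⟩
      exact (hintegral y).algebraMap
  refine ⟨⟨hfr, ?_⟩, ?_⟩
  · ext x
    exact IsIntegralClosure.isIntegral_iff (A := T)
  · have h1 : IsStrictlyClosedIn R T := strictlyClosedIn_of_sq R T M hMM hdec
    let e1 : T ≃ₐ[R] integralClosure R K := IsIntegralClosure.equiv R T K (integralClosure R K)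
    let e2 : integralClosure R K ≃ₐ[R] integralClosure R (FractionRing R) :=
      (FractionRing.algEquiv R K).symm.mapIntegralClosure
    exact strictlyClosedIn_congr (e1.trans e2) h1

/-- Let `T` be an integrally closed domain, `A` a subring of `T`, and `V` a
non-empty subset of `T` with `0 ∉ V` and `T = A[V]`.  Put
`R = A[{fg : f, g ∈ V} ∪ {f³ : f ∈ V}]`.  Then `Q(R) = Q(T)` (the fraction field of `T` is a
fraction field of `R`), `T` is the integral closure of `R` in it, `R` is strictly closed, and
hence `R` is a weakly Arf ring. -/
theorem cubesAndProductsAdjoin_strictlyClosed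
    (T : Type*) [CommRing T] [IsDomain T] [IsIntegrallyClosed T]
    (A : Subring T) (V : Set T) (hVne : V.Nonempty) (h0 : (0 : T) ∉ V)
    (hgen : Subring.closure ((A : Set T) ∪ V) = ⊤) :
    (letI : Algebra (cubesAndProductsAdjoin A V) T := (cubesAndProductsAdjoin A V).subtype.toAlgebra
     letI : Algebra (cubesAndProductsAdjoin A V) (FractionRing T) :=
       ((algebraMap T (FractionRing T)).comp (cubesAndProductsAdjoin A V).subtype).toAlgebra
     IsFractionRing (cubesAndProductsAdjoin A V) (FractionRing T) ∧
       (integralClosure (cubesAndProductsAdjoin A V) (FractionRing T) : Set (FractionRing T))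
         = Set.range (algebraMap T (FractionRing T))) ∧
    IsStrictlyClosed (cubesAndProductsAdjoin A V) ∧
    IsWeaklyArf (cubesAndProductsAdjoin A V) := by
  have hsc := fun (i1 : Algebra (cubesAndProductsAdjoin A V) T)
      (i2 : Algebra (cubesAndProductsAdjoin A V) (FractionRing T))
      (i3 : @IsScalarTower (cubesAndProductsAdjoin A V) T (FractionRing T) i1.toSMul _ i2.toSMul)
      (hi : ∀ x : cubesAndProductsAdjoin A V,
        @algebraMap (cubesAndProductsAdjoin A V) T _ _ i1 x = x) =>
    @strictlyClosed_aux (cubesAndProductsAdjoin A V) T (FractionRing T) _ _ _ _ _ _ _ _ i1 i2 i3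
      (fun x y h => Subtype.ext (by rw [← hi, ← hi, h])) V hVne h0
      (fun f hf g hg => ⟨⟨f * g, Subring.subset_closure (Or.inl (Or.inr ⟨f, hf, g, hg, rfl⟩))⟩, hi _⟩)
      (fun f hf => ⟨⟨f ^ 3, Subring.subset_closure (Or.inr ⟨f, hf, rfl⟩)⟩, hi _⟩)
      A (fun a ha => ⟨⟨a, Subring.subset_closure (Or.inl (Or.inl ha))⟩, hi _⟩) hgen
  letI i1 : Algebra (cubesAndProductsAdjoin A V) T :=
    (cubesAndProductsAdjoin A V).subtype.toAlgebra
  letI i2 : Algebra (cubesAndProductsAdjoin A V) (FractionRing T) :=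
    ((algebraMap T (FractionRing T)).comp (cubesAndProductsAdjoin A V).subtype).toAlgebra
  have i3 : @IsScalarTower (cubesAndProductsAdjoin A V) T (FractionRing T) i1.toSMul _ i2.toSMul :=
    @IsScalarTower.of_algebraMap_eq _ _ _ _ _ _ i1 _ i2 (fun _ => rfl)
  have h := hsc i1 i2 i3 (fun _ => rfl)
  exact ⟨h.1, h.2, weaklyArf_of_strictlyClosed h.2⟩
end

section
/- Let (R, 𝔪) be a two-dimensional regular local ring with 𝔪 = (x, y). Let I = (x³, xy⁴, y⁵), J = (x³, x²y², xy⁴, y⁵), and let 𝓡 = R[It] be the Rees algebra of I inside R[t]. Then the integral closure of 𝓡 in its total ring of fractions is R[Jt], and 𝓡 is strictly closed; in particular 𝓡 is not integrally closed (𝓡 ≠ R[Jt]). -/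
open scoped TensorProduct

/-- The Rees algebra `R[It]` of an ideal `I`: the `R`-subalgebra of the polynomial ring `R[t]`
generated by the elements `a·t` with `a ∈ I`. -/
noncomputable def ReesAlg {R : Type*} [CommRing R] (I : Ideal R) : Subalgebra R (Polynomial R) :=
  Algebra.adjoin R ((fun a => Polynomial.C a * Polynomial.X) '' (I : Set R))

section Part1
open IsLocalRing
variable {R : Type*} [CommRing R] [IsNoetherianRing R] [IsLocalRing R]

theorem krull_closed (z : R) (hz : z ∈ maximalIdeal R) (I : Ideal R) (f : R)
    (h : ∀ k : ℕ, ∃ g, f - z ^ k * g ∈ I) : f ∈ I := by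
  have H := Ideal.iInf_pow_smul_eq_bot_of_isLocalRing (R := R) (M := R ⧸ I) (Ideal.span {z})
    (by
      intro h
      rw [Ideal.span_singleton_eq_top] at h
      exact (mem_maximalIdeal z).1 hz h)
  rw [← Ideal.Quotient.eq_zero_iff_mem]
  have : (Ideal.Quotient.mk I f) ∈ (⨅ i : ℕ, Ideal.span {z} ^ i • ⊤ : Submodule R (R ⧸ I)) := by
    rw [Submodule.mem_iInf]
    intro k
    obtain ⟨g, hg⟩ := h k
    rw [Ideal.Quotient.eq.2 hg, map_mul]
    have : Ideal.Quotient.mk I (z ^ k) * Ideal.Quotient.mk I g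
      = (z ^ k) • Ideal.Quotient.mk I g := rfl
    rw [this]
    apply Submodule.smul_mem_smul
    · exact Ideal.pow_mem_pow (Ideal.mem_span_singleton_self z) k
    · trivial
  rw [H] at this
  simpa using this

/-- normal form modulo `x` -/
theorem normal_form (x y : R) (hm : maximalIdeal R = Ideal.span {x, y}) (f : R) (hf : ¬ x ∣ f) :
    ∃ (k : ℕ) (u g : R), IsUnit u ∧ f = u * y ^ k + x * g := by
  classical
  have hy : y ∈ maximalIdeal R := by rw [hm]; exact Ideal.subset_span (by simp)
  have h1 : ∃ k : ℕ, ¬ ∃ g, x ∣ f - y ^ k * g := by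
    by_contra! h
    apply hf
    rw [← Ideal.mem_span_singleton]
    apply krull_closed y hy
    simpa [Ideal.mem_span_singleton] using h
  have h2 := Nat.find_spec h1
  have h3 := fun m => Nat.find_min (m := m) h1
  generalize Nat.find h1 = k at h2 h3
  cases k with
  | zero => exact absurd ⟨f, by simp⟩ h2
  | succ k =>
    have := h3 k (by omega)
    push Not at this
    obtain ⟨u, g, hg⟩ := this
    refine ⟨k, u, g, ?_, by linear_combination hg⟩
    by_contra hu
    have hu : u ∈ maximalIdeal R := hu
    rw [hm, Ideal.mem_span_pair] at hu
    obtain ⟨a, b, hab⟩ := hu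
    exact h2 ⟨b, g + y ^ k * a, by rw [← hab] at hg; linear_combination hg⟩

theorem y_pow_not (hdim : ringKrullDim R = 2) (x y : R)
    (hm : maximalIdeal R = Ideal.span {x, y}) (k : ℕ) : ¬ x ∣ y ^ k := by
  intro h
  have hx : x ∈ maximalIdeal R := by rw [hm]; exact Ideal.subset_span (by simp)
  have h1 : maximalIdeal R ∈ (Ideal.span {x}).minimalPrimes := by
    refine ⟨⟨inferInstance, by simpa [Ideal.span_le] using hx⟩, ?_⟩
    rintro Q ⟨hQ, hxQ⟩ -
    have hxQ : x ∈ Q := hxQ (Ideal.mem_span_singleton_self x)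
    rw [hm, Ideal.span_le]
    rintro z (rfl | rfl)
    · exact hxQ
    · exact hQ.mem_of_pow_mem k (Q.mem_of_dvd h hxQ)
  have h2 := Ideal.height_le_one_of_isPrincipal_of_mem_minimalPrimes _ _ h1
  have h3 := maximalIdeal_height_eq_ringKrullDim (R := R)
  rw [hdim] at h3
  have h4 : (maximalIdeal R).height = 2 := WithBot.coe_injective h3
  rw [h4] at h2
  exact absurd h2 (by decide)

theorem x_prime' (hdim : ringKrullDim R = 2) (x y : R)
    (hm : maximalIdeal R = Ideal.span {x, y}) (f g : R) (h : x ∣ f * g) : x ∣ f ∨ x ∣ g := by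
  by_contra! hc
  obtain ⟨k, u, f', hu, hf⟩ := normal_form x y hm f hc.1
  obtain ⟨l, v, g', hv, hg⟩ := normal_form x y hm g hc.2
  apply y_pow_not hdim x y hm (k + l)
  obtain ⟨c, hc⟩ := h
  rw [← (hu.mul hv).dvd_mul_left (a := x)]
  refine ⟨c - f' * g - u * y ^ k * g', ?_⟩
  rw [hf, hg] at hc
  rw [hg]
  linear_combination hc

theorem exists_good_prime (hdim : ringKrullDim R = 2) (x y : R)
    (hm : maximalIdeal R = Ideal.span {x, y}) :
    ∃ P : Ideal R, P.IsPrime ∧ x ∉ P ∧ ∀ f ∈ P, x ∣ f := by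
  have hx : x ∈ maximalIdeal R := by rw [hm]; exact Ideal.subset_span (by simp)
  obtain ⟨l, hl⟩ := Order.le_krullDim_iff.1 (show ((2 : ℕ) : WithBot ℕ∞) ≤ Order.krullDim (PrimeSpectrum R) from hdim.ge)
  obtain ⟨P, P1, P2, h01, h12⟩ : ∃ P P1 P2 : PrimeSpectrum R, P < P1 ∧ P1 < P2 :=
    ⟨l ⟨0, by omega⟩, l ⟨1, by omega⟩, l ⟨2, by omega⟩, l.strictMono (Fin.mk_lt_mk.2 (by omega)),
      l.strictMono (Fin.mk_lt_mk.2 (by omega))⟩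
  have key : ∀ Q : PrimeSpectrum R, x ∈ Q.asIdeal → y ∈ Q.asIdeal → ¬ Q < P2 := by
    intro Q h1 h2 h3
    have : maximalIdeal R ≤ Q.asIdeal := by
      rw [hm, Ideal.span_le]
      rintro z (rfl | rfl) <;> assumption
    exact absurd (lt_of_lt_of_le h3 ((le_maximalIdeal P2.isPrime.ne_top).trans this)) (lt_irrefl _)
  have key2 : ∀ Q : PrimeSpectrum R, x ∈ Q.asIdeal → ∀ f ∈ Q.asIdeal, ¬ x ∣ f → y ∈ Q.asIdeal := by
    intro Q h1 f hf hxf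
    obtain ⟨k, u, f', hu, hf'⟩ := normal_form x y hm f hxf
    have : u * y ^ k ∈ Q.asIdeal := by
      have : u * y ^ k = f - f' * x := by rw [hf']; ring
      rw [this]
      exact Ideal.sub_mem _ hf (Ideal.mul_mem_left _ _ h1)
    rw [Ideal.unit_mul_mem_iff_mem _ hu] at this
    exact Q.isPrime.mem_of_pow_mem k this
  refine ⟨P.asIdeal, P.isPrime, ?_, ?_⟩
  · intro hxP
    have h01' : P.asIdeal < P1.asIdeal := h01
    obtain ⟨f, hf1, hf0⟩ := Set.exists_of_ssubset h01'
    exact key P1 (h01'.le hxP) (key2 P1 (h01'.le hxP) f hf1 fun hh => hf0 (P.asIdeal.mem_of_dvd hh hxP)) h12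
  · intro f hf
    by_contra hxf
    have hmin : maximalIdeal R ∈ (P.asIdeal ⊔ Ideal.span {x}).minimalPrimes := by
      refine ⟨⟨inferInstance, sup_le (le_maximalIdeal P.isPrime.ne_top)
        (by simpa [Ideal.span_le] using hx)⟩, ?_⟩
      rintro Q ⟨hQ, hxQ⟩ -
      have hxQ' : x ∈ Q := hxQ (Ideal.mem_sup_right (Ideal.mem_span_singleton_self x))
      have := key2 ⟨Q, hQ⟩ hxQ' f (hxQ (Ideal.mem_sup_left hf)) hxf
      rw [hm, Ideal.span_le]
      rintro z (rfl | rfl) <;> assumption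
    have h1 := Ideal.map_height_le_one_of_mem_minimalPrimes hmin
    have hs : Function.Surjective (Ideal.Quotient.mk P.asIdeal) := Ideal.Quotient.mk_surjective
    have hmk : ∀ Q : PrimeSpectrum R, P ≤ Q → (Q.asIdeal.map (Ideal.Quotient.mk P.asIdeal)).IsPrime :=
      fun Q hQ => by
        have := Q.isPrime
        exact Ideal.map_isPrime_of_surjective hs (by simpa using hQ)
    have hlt : ∀ Q Q' : PrimeSpectrum R, P ≤ Q → Q < Q' →
      Q.asIdeal.map (Ideal.Quotient.mk P.asIdeal) < Q'.asIdeal.map (Ideal.Quotient.mk P.asIdeal) := by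
      intro Q Q' hQ hQQ'
      have hQQ' : Q.asIdeal < Q'.asIdeal := hQQ'
      refine lt_of_le_not_ge (Ideal.map_mono hQQ'.le) fun h => ?_
      have := Ideal.comap_mono (f := Ideal.Quotient.mk P.asIdeal) h
      rw [Ideal.comap_map_of_surjective' _ hs, Ideal.comap_map_of_surjective' _ hs, Ideal.mk_ker,
        sup_eq_left.2 (show P.asIdeal ≤ Q.asIdeal from hQ),
        sup_eq_left.2 (show P.asIdeal ≤ Q'.asIdeal from le_trans hQ hQQ'.le)] at this
      exact absurd (lt_of_lt_of_le hQQ' this) (lt_irrefl _)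
    have h2 := hlt P P1 le_rfl h01
    have h3 := hlt P1 P2 h01.le h12
    have h4 : P2.asIdeal.map (Ideal.Quotient.mk P.asIdeal) ≤ _ :=
      Ideal.map_mono (le_maximalIdeal P2.isPrime.ne_top)
    have i0 := hmk P le_rfl
    have i1 := hmk P1 h01.le
    have i2 := hmk P2 (h01.trans h12).le
    have e1 := Ideal.height_strict_mono_of_isPrime h2
    have e2 := Ideal.height_strict_mono_of_isPrime h3
    have e3 := Ideal.height_mono h4
    have := e2.trans_le (e3.trans h1)
    have : (Ideal.map (Ideal.Quotient.mk P.asIdeal) P1.asIdeal).height = 0 := by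
      simpa using this
    rw [this] at e1
    simp at e1

theorem R_domain (hdim : ringKrullDim R = 2) (x y : R)
    (hm : maximalIdeal R = Ideal.span {x, y}) : IsDomain R := by
  obtain ⟨P, hP, hxP, hPx⟩ := exists_good_prime hdim x y hm
  have hx : x ∈ maximalIdeal R := by rw [hm]; exact Ideal.subset_span (by simp)
  have : P = ⊥ := by
    apply Submodule.eq_bot_of_le_smul_of_le_jacobson_bot (Ideal.span {x}) P (IsNoetherian.noetherian _)
    · intro f hf
      obtain ⟨g, rfl⟩ := hPx f hf
      exact Submodule.smul_mem_smul (Ideal.mem_span_singleton_self x)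
        ((hP.mem_or_mem hf).resolve_left hxP)
    · refine le_trans ?_ (maximalIdeal_le_jacobson _)
      simpa [Ideal.span_le] using hx
  subst this
  exact IsDomain.of_bot_isPrime R

theorem x_prime (hdim : ringKrullDim R = 2) (x y : R)
    (hm : maximalIdeal R = Ideal.span {x, y}) : Prime x := by
  have := R_domain hdim x y hm
  obtain ⟨P, hP, hxP, hPx⟩ := exists_good_prime hdim x y hm
  have hx : x ∈ maximalIdeal R := by rw [hm]; exact Ideal.subset_span (by simp)
  refine ⟨?_, hx, x_prime' hdim x y hm⟩
  rintro rfl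
  exact hxP P.zero_mem

/-- mod-x divisibility by powers of y -/
theorem dvd_step (hdim : ringKrullDim R = 2) (x y : R)
    (hm : maximalIdeal R = Ideal.span {x, y}) (f g d : R) (hg : ¬ x ∣ g) (hd : ¬ x ∣ d)
    (h : ∀ n : ℕ, g ^ n ∣ d * f ^ n) : ∃ w f1, f = g * w + x * f1 ∧ ∀ n, g ^ n ∣ d * f1 ^ n := by
  have := R_domain hdim x y hm
  have hxp := x_prime hdim x y hm
  have h1 : ∃ w f1, f = g * w + x * f1 := by
    by_cases hf : x ∣ f
    · obtain ⟨c, rfl⟩ := hf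
      exact ⟨0, c, by ring⟩
    obtain ⟨a, u, f', hu, ef⟩ := normal_form x y hm f hf
    obtain ⟨b, v, g', hv, eg⟩ := normal_form x y hm g hg
    obtain ⟨c, w, d', hw, ed⟩ := normal_form x y hm d hd
    have hba : b ≤ a := by
      by_contra! hab
      obtain ⟨q, hq⟩ := h (c + 1)
      have hc : c + a * (c + 1) < b * (c + 1) := by nlinarith
      obtain ⟨e, he⟩ := Nat.exists_eq_add_of_lt hc
      -- pass to quotient
      have hq' := congrArg (Ideal.Quotient.mk (Ideal.span {x})) hq
      have hx0 : Ideal.Quotient.mk (Ideal.span {x}) x = 0 := by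
        rw [Ideal.Quotient.eq_zero_iff_mem]; exact Ideal.mem_span_singleton_self x
      rw [ef, eg, ed] at hq'
      simp only [map_mul, map_add, map_pow, hx0, zero_mul, add_zero] at hq'
      have h2 : Ideal.Quotient.mk (Ideal.span {x})
          (y ^ (c + a * (c + 1)) * (w * u ^ (c + 1) - v ^ (c + 1) * y ^ (e + 1) * q)) = 0 := by
        simp only [map_mul, map_sub, map_pow]
        have h3 : b * (c + 1) = c + a * (c + 1) + (e + 1) := by omega
        have h4 : ∀ Y : R ⧸ Ideal.span {x}, (Y ^ b) ^ (c + 1) = Y ^ (c + a * (c + 1)) * Y ^ (e + 1) := by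
          intro Y; rw [← pow_mul, h3, pow_add]
        simp only [mul_pow, h4] at hq'
        linear_combination hq'
      rw [Ideal.Quotient.eq_zero_iff_mem, Ideal.mem_span_singleton] at h2
      have h3 := (hxp.dvd_or_dvd h2).resolve_left (y_pow_not hdim x y hm _)
      have hy : y ∈ maximalIdeal R := by rw [hm]; exact Ideal.subset_span (by simp)
      have hx : x ∈ maximalIdeal R := by rw [hm]; exact Ideal.subset_span (by simp)
      have h4 : w * u ^ (c + 1) ∈ maximalIdeal R := by
        have h5 := (maximalIdeal R).mem_of_dvd h3 hx
        have h6 : v ^ (c + 1) * y ^ (e + 1) * q ∈ maximalIdeal R :=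
          Ideal.mul_mem_right _ _ (Ideal.mul_mem_left _ _ (Ideal.pow_mem_of_mem _ hy _ (by omega)))
        simpa using Ideal.add_mem _ h5 h6
      exact h4 (hw.mul (hu.pow _))
    obtain ⟨v', hv'⟩ := hv.exists_right_inv
    refine ⟨v' * u * y ^ (a - b), f' - g' * v' * u * y ^ (a - b), ?_⟩
    rw [ef, eg]
    obtain ⟨e, rfl⟩ := Nat.exists_eq_add_of_le hba
    simp only [Nat.add_sub_cancel_left, pow_add]
    linear_combination (-u * y ^ b * y ^ e) * hv'
  obtain ⟨w, f1, hf⟩ := h1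
  refine ⟨w, f1, hf, fun n => ?_⟩
  have h2 : g ^ n ∣ x ^ n * (d * f1 ^ n) := by
    have : x ^ n * (d * f1 ^ n) = d * (f + -(g * w)) ^ n := by
      rw [hf]; ring
    rw [this, add_pow, Finset.mul_sum]
    apply Finset.dvd_sum
    intro i hi
    have hi : i ≤ n := by simpa [Nat.lt_succ_iff] using hi
    have h3 : g ^ n = g ^ i * g ^ (n - i) := by rw [← pow_add]; congr 1; omega
    rw [h3]
    have : d * (f ^ i * (-(g * w)) ^ (n - i) * (n.choose i : R)) =
      (d * f ^ i) * g ^ (n - i) * ((-w) ^ (n - i) * (n.choose i : R)) := by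
      rw [show -(g * w) = g * (-w) by ring, mul_pow]; ring
    rw [this]
    exact Dvd.dvd.mul_right (mul_dvd_mul_right (h i) _) _
  obtain ⟨q, hq⟩ := h2
  have h3 : x ^ n ∣ g ^ n * q := ⟨_, hq.symm⟩
  have h4 : x ^ n ∣ q := hxp.pow_dvd_of_dvd_mul_left n (fun h => hg (hxp.dvd_of_dvd_pow h)) h3
  obtain ⟨r, rfl⟩ := h4
  refine ⟨r, ?_⟩
  apply mul_left_cancel₀ (pow_ne_zero n hxp.ne_zero)
  linear_combination hq

theorem dvd_final (hdim : ringKrullDim R = 2) (x y : R)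
    (hm : maximalIdeal R = Ideal.span {x, y}) (f g d : R) (hg : ¬ x ∣ g) (hd : ¬ x ∣ d)
    (h : ∀ n : ℕ, g ^ n ∣ d * f ^ n) : g ∣ f := by
  have hx : x ∈ maximalIdeal R := by rw [hm]; exact Ideal.subset_span (by simp)
  have key : ∀ k : ℕ, ∃ w f1, f = g * w + x ^ k * f1 ∧ ∀ n, g ^ n ∣ d * f1 ^ n := by
    intro k
    induction k with
    | zero => exact ⟨0, f, by simp, h⟩
    | succ k ih =>
      obtain ⟨w, f1, h1, h2⟩ := ih
      obtain ⟨w', f2, h3, h4⟩ := dvd_step hdim x y hm f1 g d hg hd h2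
      refine ⟨w + x ^ k * w', f2, ?_, h4⟩
      rw [h1, h3]; ring
  rw [← Ideal.mem_span_singleton]
  apply krull_closed x hx
  intro k
  obtain ⟨w, f1, h1, -⟩ := key k
  exact ⟨f1, by rw [Ideal.mem_span_singleton]; exact ⟨w, by rw [h1]; ring⟩⟩

theorem dvd_final' (hdim : ringKrullDim R = 2) (x y : R)
    (hm : maximalIdeal R = Ideal.span {x, y}) (f g d : R) (hg : g ≠ 0) (hd : d ≠ 0)
    (h : ∀ n : ℕ, g ^ n ∣ d * f ^ n) : g ∣ f := by
  have := R_domain hdim x y hm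
  have hxp := x_prime hdim x y hm
  by_cases hf : f = 0
  · simp [hf]
  have fm : ∀ z : R, z ≠ 0 → FiniteMultiplicity x z := fun z hz =>
    FiniteMultiplicity.of_not_isUnit hxp.not_isUnit hz
  obtain ⟨a, eg, ha⟩ := (fm g hg).exists_eq_pow_mul_and_not_dvd
  obtain ⟨b, ed, hb⟩ := (fm d hd).exists_eq_pow_mul_and_not_dvd
  obtain ⟨c, ef, hc⟩ := (fm f hf).exists_eq_pow_mul_and_not_dvd
  generalize multiplicity x g = i at eg
  generalize multiplicity x d = j at ed
  generalize multiplicity x f = k at ef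
  subst eg ed ef
  have hik : i ≤ k := by
    by_contra! hik
    have h1 := h (j + 1)
    have h2 : x ^ (j + k * (j + 1) + 1) ∣ x ^ (j + k * (j + 1)) * (b * c ^ (j + 1)) := by
      have e1 : x ^ (j + k * (j + 1)) * (b * c ^ (j + 1)) = x ^ j * b * (x ^ k * c) ^ (j + 1) := by
        rw [mul_pow, ← pow_mul, pow_add]; ring
      rw [e1]
      refine dvd_trans ?_ h1
      rw [mul_pow, ← pow_mul]
      refine Dvd.dvd.mul_right (pow_dvd_pow _ ?_) _
      nlinarith
    rw [pow_succ] at h2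
    have h3 := (mul_dvd_mul_iff_left (pow_ne_zero _ hxp.ne_zero)).1 h2
    rcases hxp.dvd_or_dvd h3 with h4 | h4
    · exact hb h4
    · exact hc (hxp.dvd_of_dvd_pow h4)
  obtain ⟨e, rfl⟩ := Nat.exists_eq_add_of_le hik
  rw [pow_add, mul_assoc]
  apply mul_dvd_mul_left
  apply dvd_final hdim x y hm _ a b ha hb
  intro n
  have h1 := h n
  have h2 : a ^ n ∣ x ^ j * (b * (x ^ e * c) ^ n) := by
    rw [pow_add, mul_assoc, mul_pow, mul_pow] at h1
    apply (mul_dvd_mul_iff_left (pow_ne_zero n (pow_ne_zero i hxp.ne_zero))).1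
    convert h1 using 1
    ring
  obtain ⟨q, hq⟩ := h2
  have h4 : x ^ j ∣ q := hxp.pow_dvd_of_dvd_mul_left j (fun h => ha (hxp.dvd_of_dvd_pow h))
    ⟨_, hq.symm⟩
  obtain ⟨r, rfl⟩ := h4
  refine ⟨r, ?_⟩
  apply mul_left_cancel₀ (pow_ne_zero j hxp.ne_zero)
  linear_combination hq

theorem R_normal (hdim : ringKrullDim R = 2) (x y : R)
    (hm : maximalIdeal R = Ideal.span {x, y}) [IsDomain R] : IsIntegrallyClosed R := by
  rw [isIntegrallyClosed_iff (FractionRing R)]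
  intro z hz
  obtain ⟨d, hd, h⟩ : IsAlmostIntegral R z := hz.isAlmostIntegral
  obtain ⟨f, g, hg, rfl⟩ := IsFractionRing.div_surjective (A := R) z
  have hg0 := nonZeroDivisors.ne_zero hg
  have hg1 : algebraMap R (FractionRing R) g ≠ 0 := by simpa using hg0
  obtain ⟨w, rfl⟩ := dvd_final' hdim x y hm f g d hg0 (nonZeroDivisors.ne_zero hd) (by
    intro n
    obtain ⟨r, hr⟩ := h n
    refine ⟨r, ?_⟩
    apply IsFractionRing.injective R (FractionRing R)
    rw [Algebra.smul_def, div_pow] at hr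
    field_simp at hr
    simp only [map_mul, map_pow]
    rw [← hr]; ring)
  exact ⟨w, by rw [map_mul]; field_simp⟩

end Part1
section Part2
open Polynomial IsLocalRing
variable {R : Type*} [CommRing R]

/-- weighted monomial filtration with `x` of weight `5` and `y` of weight `3` -/
def WF (x y : R) (n : ℕ) : Ideal R :=
  Ideal.span {z | ∃ a b : ℕ, n ≤ 5 * a + 3 * b ∧ z = x ^ a * y ^ b}

theorem WF_mono {x y : R} (a b n : ℕ) (h : n ≤ 5 * a + 3 * b) : x ^ a * y ^ b ∈ WF x y n :=
  Ideal.subset_span ⟨a, b, h, rfl⟩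

theorem WF_anti {x y : R} {n m : ℕ} (h : n ≤ m) : WF x y m ≤ WF x y n := by
  apply Ideal.span_mono
  rintro z ⟨a, b, h1, rfl⟩
  exact ⟨a, b, h.trans h1, rfl⟩

theorem WF_zero (x y : R) : WF x y 0 = ⊤ := by
  rw [Ideal.eq_top_iff_one]
  simpa using WF_mono (x := x) (y := y) 0 0 0 (by simp)

theorem WF_mul {x y : R} {n m : ℕ} {f g : R} (hf : f ∈ WF x y n) (hg : g ∈ WF x y m) :
    f * g ∈ WF x y (n + m) := by
  have : WF x y n * WF x y m ≤ WF x y (n + m) := by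
    rw [WF, WF, Ideal.span_mul_span', Ideal.span_le]
    rintro _ ⟨_, ⟨a, b, h, rfl⟩, _, ⟨c, d, h', rfl⟩, rfl⟩
    have := WF_mono (x := x) (y := y) (a + c) (b + d) (n + m) (by omega)
    simp only [SetLike.mem_coe]
    convert this using 1
    ring
  exact this (Ideal.mul_mem_mul hf hg)

theorem WF_decomp {x y : R} {n : ℕ} {f : R} (hf : f ∈ WF x y n) :
    ∃ h g, g ∈ WF x y (n - 5) ∧ f = y ^ ((n + 2) / 3) * h + x * g := by
  rw [WF] at hf
  induction hf using Submodule.span_induction with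
  | mem z hz =>
    obtain ⟨a, b, h, rfl⟩ := hz
    rcases a with _ | a
    · obtain ⟨e, he⟩ := Nat.exists_eq_add_of_le (show (n + 2) / 3 ≤ b by omega)
      exact ⟨y ^ e, 0, Ideal.zero_mem _, by rw [he, pow_add]; simp⟩
    · exact ⟨0, x ^ a * y ^ b, WF_mono _ _ _ (by omega), by ring⟩
  | zero => exact ⟨0, 0, Ideal.zero_mem _, by simp⟩
  | add p q _ _ hp hq =>
    obtain ⟨h, g, hg, rfl⟩ := hp
    obtain ⟨h', g', hg', rfl⟩ := hq
    exact ⟨h + h', g + g', Ideal.add_mem _ hg hg', by ring⟩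
  | smul r p _ hp =>
    obtain ⟨h, g, hg, rfl⟩ := hp
    exact ⟨r * h, r * g, Ideal.mul_mem_left _ _ hg, by simp only [smul_eq_mul]; ring⟩

variable [IsDomain R]

theorem WF_colon {x y : R} (hx : Prime x) (hxy : ¬ x ∣ y) {n : ℕ} {f : R} (hf : x * f ∈ WF x y n) :
    f ∈ WF x y (n - 5) := by
  obtain ⟨h, g, hg, e⟩ := WF_decomp hf
  have h1 : x ∣ y ^ ((n + 2) / 3) * h := ⟨f - g, by linear_combination -e⟩
  rcases hx.dvd_or_dvd h1 with h2 | ⟨c, rfl⟩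
  · exact absurd (hx.dvd_of_dvd_pow h2) hxy
  have : f = y ^ ((n + 2) / 3) * c + g := by
    apply mul_left_cancel₀ hx.ne_zero
    linear_combination e
  rw [this]
  refine Ideal.add_mem _ (Ideal.mul_mem_right _ _ ?_) hg
  simpa using WF_mono (x := x) (y := y) 0 ((n + 2) / 3) (n - 5) (by omega)

variable [IsLocalRing R]

theorem WF_dichotomy {x y : R} (hm : maximalIdeal R = Ideal.span {x, y})
    {n : ℕ} {f : R} (hf : f ∈ WF x y n) (hf' : f ∉ WF x y (n + 1)) :
    (5 ≤ n ∧ ∃ f1, f - x * f1 ∈ WF x y (n + 1) ∧ f1 ∈ WF x y (n - 5) ∧ f1 ∉ WF x y (n - 5 + 1)) ∨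
    (∃ k h f1, n = 3 * k ∧ IsUnit h ∧ f = y ^ k * h + x * f1) := by
  obtain ⟨h, g, hg, e⟩ := WF_decomp hf
  by_cases hc : n % 3 = 0 ∧ IsUnit h
  · right
    exact ⟨n / 3, h, g, by omega, hc.2, by rw [e]; congr 3; omega⟩
  · left
    have h1 : y ^ ((n + 2) / 3) * h ∈ WF x y (n + 1) := by
      by_cases h3 : n % 3 = 0
      · have hu : h ∈ maximalIdeal R := fun hu => hc ⟨h3, hu⟩
        rw [hm, Ideal.mem_span_pair] at hu
        obtain ⟨a, b, rfl⟩ := hu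
        have e1 := WF_mono (x := x) (y := y) 1 ((n + 2) / 3) (n + 1) (by omega)
        have e2 := WF_mono (x := x) (y := y) 0 ((n + 2) / 3 + 1) (n + 1) (by omega)
        have := Ideal.add_mem _ (Ideal.mul_mem_left _ a e1) (Ideal.mul_mem_left _ b e2)
        convert this using 1
        ring
      · refine Ideal.mul_mem_right _ _ ?_
        simpa using WF_mono (x := x) (y := y) 0 ((n + 2) / 3) (n + 1) (by omega)
    have hx5 : x ∈ WF x y 5 := by simpa using WF_mono (x := x) (y := y) 1 0 5 (by omega)
    have hn : 5 ≤ n := by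
      by_contra hn
      apply hf'
      rw [e]
      exact Ideal.add_mem _ h1 (Ideal.mul_mem_right _ _ (WF_anti (by omega) hx5))
    refine ⟨hn, g, ?_, hg, ?_⟩
    · rw [e]; simpa using h1
    · intro hg'
      apply hf'
      rw [e]
      exact Ideal.add_mem _ h1 (WF_anti (by omega) (WF_mul hx5 hg'))

theorem WF_val {x y : R} (hm : maximalIdeal R = Ideal.span {x, y}) (hx : Prime x) (hxy : ¬ x ∣ y)
    (s : ℕ) : ∀ {n m : ℕ} {f g : R}, n + m = s → f ∈ WF x y n → f ∉ WF x y (n + 1) →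
    g ∈ WF x y m → g ∉ WF x y (m + 1) → f * g ∉ WF x y (n + m + 1) := by
  induction s using Nat.strong_induction_on with
  | _ s ih =>
  intro n m f g hs hf hf' hg hg' hfg
  rcases WF_dichotomy hm hf hf' with ⟨h5, f1, h1, h2, h3⟩ | ⟨k, h, f1, hk, hu, ef⟩
  · refine ih (n - 5 + m) (by omega) rfl h2 h3 hg hg' ?_
    have : x * (f1 * g) ∈ WF x y (n + m + 1) := by
      have h4 := WF_anti (show n + m + 1 ≤ n + 1 + m by omega) (WF_mul h1 hg)
      have := Ideal.sub_mem _ hfg h4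
      convert this using 1; ring
    exact WF_anti (by omega) (WF_colon hx hxy this)
  rcases WF_dichotomy hm hg hg' with ⟨h5, g1, h1, h2, h3⟩ | ⟨l, h', g1, hl, hu', eg⟩
  · refine ih (n + (m - 5)) (by omega) rfl hf hf' h2 h3 ?_
    have : x * (f * g1) ∈ WF x y (n + m + 1) := by
      have h4 := WF_anti (show n + m + 1 ≤ n + (m + 1) by omega) (WF_mul hf h1)
      have := Ideal.sub_mem _ hfg h4
      convert this using 1; ring
    exact WF_anti (by omega) (WF_colon hx hxy this)
  obtain ⟨a, b, -, e⟩ := WF_decomp hfg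
  have e0 : (n + m + 1 + 2) / 3 = k + l + 1 := by omega
  rw [e0] at e
  have h1 : x ∣ y ^ (k + l) * (h * h' - y * a) :=
    ⟨b - f1 * g - y ^ k * h * g1, by rw [ef, eg] at e; rw [eg]; linear_combination e⟩
  rcases hx.dvd_or_dvd h1 with h2 | h2
  · exact hxy (hx.dvd_of_dvd_pow h2)
  have hym : y ∈ maximalIdeal R := by rw [hm]; exact Ideal.subset_span (by simp)
  have hxm : x ∈ maximalIdeal R := by rw [hm]; exact Ideal.subset_span (by simp)
  have h3 := (maximalIdeal R).mem_of_dvd h2 hxm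
  have h4 : h * h' ∈ maximalIdeal R := by
    simpa using Ideal.add_mem _ h3 (Ideal.mul_mem_right a _ hym)
  exact h4 (hu.mul hu')

theorem WF_le_pow (x y : R) (i : ℕ) :
    WF x y (15 * i) ≤ (Ideal.span {x ^ 3, x ^ 2 * y ^ 2, x * y ^ 4, y ^ 5}) ^ i := by
  rw [WF, Ideal.span_le]
  rintro _ ⟨a, b, h, rfl⟩
  simp only [SetLike.mem_coe]
  set J : Ideal R := Ideal.span {x ^ 3, x ^ 2 * y ^ 2, x * y ^ 4, y ^ 5} with hJ
  have j1 : x ^ 3 ∈ J := Ideal.subset_span (by simp)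
  have j2 : x ^ 2 * y ^ 2 ∈ J := Ideal.subset_span (by simp)
  have j3 : x * y ^ 4 ∈ J := Ideal.subset_span (by simp)
  have j4 : y ^ 5 ∈ J := Ideal.subset_span (by simp)
  induction i generalizing a b with
  | zero => simp
  | succ i ih =>
    rw [pow_succ]
    by_cases h1 : 3 ≤ a
    · obtain ⟨c, rfl⟩ := Nat.exists_eq_add_of_le h1
      have := Ideal.mul_mem_mul (ih c b (by omega)) j1
      convert this using 1; ring
    by_cases h2 : 5 ≤ b
    · obtain ⟨c, rfl⟩ := Nat.exists_eq_add_of_le h2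
      have := Ideal.mul_mem_mul (ih a c (by omega)) j4
      convert this using 1; ring
    have hi : i = 0 := by omega
    subst hi
    simp only [pow_zero, Ideal.one_eq_top, Ideal.top_mul]
    have ha : a = 2 ∨ a = 1 := by omega
    rcases ha with rfl | rfl
    · obtain ⟨c, rfl⟩ := Nat.exists_eq_add_of_le (show 2 ≤ b by omega)
      have := J.mul_mem_right (y ^ c) j2
      convert this using 1; ring
    · obtain ⟨c, rfl⟩ := Nat.exists_eq_add_of_le (show 4 ≤ b by omega)
      have := J.mul_mem_right (y ^ c) j3
      convert this using 1; ring

theorem pow_le_WF (x y : R) (i : ℕ) :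
    (Ideal.span {x ^ 3, x * y ^ 4, y ^ 5}) ^ i ≤ WF x y (15 * i) := by
  induction i with
  | zero => simp [WF_zero]
  | succ i ih =>
    rw [pow_succ, Ideal.mul_le]
    intro r hr s hs
    refine WF_mul (m := 15) (ih hr) ?_
    revert s
    change Ideal.span {x ^ 3, x * y ^ 4, y ^ 5} ≤ _
    rw [Ideal.span_le]
    rintro z (rfl | rfl | rfl)
    · simpa using WF_mono (x := x) (y := y) 3 0 15 (by omega)
    · simpa using WF_mono (x := x) (y := y) 1 4 15 (by omega)
    · simpa using WF_mono (x := x) (y := y) 0 5 15 (by omega)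

/-- the induced filtration on `R[t]`, with `t` of weight `-15` -/
def WG (x y : R) (n : ℤ) (f : R[X]) : Prop :=
  ∀ i : ℕ, f.coeff i ∈ WF x y (n + 15 * i).toNat

theorem WG_anti {x y : R} {n m : ℤ} (h : n ≤ m) {f : R[X]} (hf : WG x y m f) : WG x y n f :=
  fun i => WF_anti (by omega) (hf i)

theorem WG_mul {x y : R} {n m : ℤ} {f g : R[X]} (hf : WG x y n f) (hg : WG x y m g) :
    WG x y (n + m) (f * g) := by
  intro i
  rw [coeff_mul]
  refine Ideal.sum_mem _ fun p hp => ?_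
  rw [Finset.HasAntidiagonal.mem_antidiagonal] at hp
  exact WF_anti (by omega) (WF_mul (hf p.1) (hg p.2))

theorem WG_val {x y : R} (hm : maximalIdeal R = Ideal.span {x, y}) (hx : Prime x) (hxy : ¬ x ∣ y)
    {n m : ℤ} {f g : R[X]} (hf : WG x y n f) (hf' : ¬ WG x y (n + 1) f)
    (hg : WG x y m g) (hg' : ¬ WG x y (m + 1) g) : ¬ WG x y (n + m + 1) (f * g) := by
  classical
  have key : ∀ (n : ℤ) (f : R[X]), ¬ WG x y (n + 1) f →
      ∃ i : ℕ, 0 ≤ n + 15 * i ∧ f.coeff i ∉ WF x y ((n + 15 * i).toNat + 1) ∧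
        ∀ j, i < j → f.coeff j ∈ WF x y (n + 1 + 15 * j).toNat := by
    intro n f h
    simp only [WG, not_forall] at h
    obtain ⟨i', hi'⟩ := h
    have hs : ∀ i : ℕ, f.coeff i ∉ WF x y (n + 1 + 15 * i).toNat → i ∈ f.support := by
      intro i hi
      rw [mem_support_iff]
      intro h0
      rw [h0] at hi
      exact hi (Ideal.zero_mem _)
    obtain ⟨i, hi, hmax⟩ := Finset.exists_max_image
      (f.support.filter fun i : ℕ => f.coeff i ∉ WF x y (n + 1 + 15 * i).toNat) id
      ⟨i', by simpa only [Finset.mem_filter] using ⟨hs i' hi', hi'⟩⟩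
    rw [Finset.mem_filter] at hi
    have h0 : 0 ≤ n + 15 * i := by
      by_contra h0
      apply hi.2
      rw [show (n + 1 + 15 * (i : ℤ)).toNat = 0 by omega, WF_zero]
      trivial
    refine ⟨i, h0, ?_, ?_⟩
    · rw [show (n + 15 * (i : ℤ)).toNat + 1 = (n + 1 + 15 * (i : ℤ)).toNat by omega]
      exact hi.2
    · intro j hj
      by_contra hj'
      have := hmax j (by simpa only [Finset.mem_filter] using ⟨hs j hj', hj'⟩)
      simp at this
      omega
  obtain ⟨i, hi0, hi1, hi2⟩ := key n f hf'
  obtain ⟨j, hj0, hj1, hj2⟩ := key m g hg'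
  intro h
  have h1 := h (i + j)
  rw [coeff_mul, ← Finset.add_sum_erase _ _ (show (i, j) ∈ Finset.HasAntidiagonal.antidiagonal (i + j) by simp)] at h1
  refine WF_val hm hx hxy _ rfl (hf i) hi1 (hg j) hj1 ?_
  rw [show (n + 15 * (i : ℤ)).toNat + (m + 15 * (j : ℤ)).toNat + 1
    = (n + m + 1 + 15 * ((i + j : ℕ) : ℤ)).toNat by omega]
  refine (Ideal.add_mem_iff_left _ ?_).1 h1
  refine Ideal.sum_mem _ fun p hp => ?_
  rw [Finset.mem_erase, Finset.HasAntidiagonal.mem_antidiagonal] at hp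
  obtain ⟨hp1, hp2⟩ := hp
  by_cases hlt : i < p.1
  · exact WF_anti (by omega) (WF_mul (hi2 _ hlt) (hg p.2))
  · have : j < p.2 := by
      by_contra hlt'
      apply hp1
      ext <;> simp <;> omega
    exact WF_anti (by omega) (WF_mul (hf p.1) (hj2 _ this))

theorem WG_pow {x y : R} (hm : maximalIdeal R = Ideal.span {x, y}) (hx : Prime x) (hxy : ¬ x ∣ y)
    {n : ℤ} {f : R[X]} (hf : WG x y n f) (hf' : ¬ WG x y (n + 1) f) (k : ℕ) :
    WG x y (k * n) (f ^ k) ∧ ¬ WG x y (k * n + 1) (f ^ k) := by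
  induction k with
  | zero =>
    constructor
    · intro i
      simp only [pow_zero, coeff_one]
      split_ifs with h
      · subst h; simp [WF_zero]
      · exact Ideal.zero_mem _
    · intro h
      have h0 := h 0
      simp only [pow_zero, coeff_one_zero] at h0
      obtain ⟨a, b, -, e⟩ := WF_decomp h0
      have hym : y ∈ maximalIdeal R := by rw [hm]; exact Ideal.subset_span (by simp)
      have hxm : x ∈ maximalIdeal R := by rw [hm]; exact Ideal.subset_span (by simp)
      have : (1 : R) ∈ maximalIdeal R := by
        rw [e]
        exact Ideal.add_mem _ (Ideal.mul_mem_right _ _ (by simpa using hym))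
          (Ideal.mul_mem_right _ _ hxm)
      exact this isUnit_one
  | succ k ih =>
    rw [pow_succ]
    have e : ((k + 1 : ℕ) : ℤ) * n = k * n + n := by push_cast; ring
    rw [e]
    exact ⟨WG_mul ih.1 hf, WG_val hm hx hxy ih.1 ih.2 hf hf'⟩

theorem WG_integral {x y : R} (hm : maximalIdeal R = Ideal.span {x, y}) (hx : Prime x)
    (hxy : ¬ x ∣ y) (A : Subalgebra R R[X]) (hA : ∀ a ∈ A, WG x y 0 a) (f : R[X])
    (hf : IsIntegral A f) : WG x y 0 f := by
  classical
  by_contra h0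
  have hex : ∃ N : ℕ, WG x y (-N) f := by
    refine ⟨15 * f.natDegree, fun i => ?_⟩
    by_cases hi : i ≤ f.natDegree
    · rw [show (-((15 * f.natDegree : ℕ) : ℤ) + 15 * (i : ℤ)).toNat = 0 by omega, WF_zero]
      trivial
    · rw [coeff_eq_zero_of_natDegree_lt (by omega)]
      exact Ideal.zero_mem _
  have h1 := Nat.find_spec hex
  have h2 := fun m => Nat.find_min (m := m) hex
  generalize Nat.find hex = N at h1 h2
  cases N with
  | zero => exact h0 (by simpa using h1)
  | succ N =>
    have h3 := h2 N (by omega)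
    set n : ℤ := -((N + 1 : ℕ) : ℤ) with hn
    rw [show (-(N : ℤ)) = n + 1 by rw [hn]; push_cast; ring] at h3
    obtain ⟨p, hp, hpe⟩ := hf
    rw [eval₂_eq_sum_range, Finset.sum_range_succ, hp.coeff_natDegree, map_one, one_mul] at hpe
    refine (WG_pow hm hx hxy h1 h3 p.natDegree).2 ?_
    have e : f ^ p.natDegree =
      -∑ i ∈ Finset.range p.natDegree, (algebraMap A R[X]) (p.coeff i) * f ^ i := by
      linear_combination hpe
    rw [e]
    intro i
    rw [coeff_neg, finsetSum_coeff]
    refine Ideal.neg_mem_iff _ |>.2 (Ideal.sum_mem _ fun j hj => ?_)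
    rw [Finset.mem_range] at hj
    have h4 : WG x y (0 + j * n) ((algebraMap A R[X]) (p.coeff j) * f ^ j) :=
      WG_mul (hA _ (p.coeff j).2) (WG_pow hm hx hxy h1 h3 j).1
    refine WG_anti ?_ h4 i
    have : ((j : ℤ) + 1) * (-n) ≤ p.natDegree * (-n) :=
      mul_le_mul_of_nonneg_right (by omega) (by omega)
    have hn1 : n ≤ -1 := by omega
    nlinarith

theorem ReesAlg_eq (I : Ideal R) : ReesAlg I = reesAlgebra I := by
  rw [← adjoin_monomial_eq_reesAlgebra, ReesAlg]
  congr 1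
  ext f
  simp [C_mul_X_eq_monomial]

end Part2
section Part3
open Polynomial

theorem strict_of_cyclic (A S : Type*) [CommRing A] [CommRing S] [Algebra A S] (u : S)
    (hu : ∀ s : S, ∃ a b : A, s = algebraMap A S a + b • u) : IsStrictlyClosedIn A S := by
  intro s hs
  let N : Submodule A S := LinearMap.range (Algebra.linearMap A S)
  let φ : A →ₗ[A] S ⧸ N := LinearMap.toSpanSingleton A _ (N.mkQ u)
  have hφ : Function.Surjective φ := by
    intro q
    obtain ⟨t, rfl⟩ := N.mkQ_surjective q
    obtain ⟨a, b, rfl⟩ := hu t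
    refine ⟨b, ?_⟩
    have : N.mkQ (algebraMap A S a) = 0 := by
      rw [Submodule.mkQ_apply, Submodule.Quotient.mk_eq_zero]
      exact ⟨a, rfl⟩
    simp [φ, map_add, this, -Submodule.mkQ_apply]
  let C : Ideal A := LinearMap.ker φ
  let e : (A ⧸ C) ≃ₗ[A] S ⧸ N := φ.quotKerEquivOfSurjective hφ
  have hC : ∀ c, c ∈ C ↔ c • u ∈ N := by
    intro c
    rw [LinearMap.mem_ker]
    simp only [φ, LinearMap.toSpanSingleton_apply, ← map_smul]
    rw [Submodule.mkQ_apply, Submodule.Quotient.mk_eq_zero]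
  let Ψ : S ⊗[A] S →ₗ[A] S ⧸ (C • (⊤ : Submodule A S)) :=
    (TensorProduct.quotTensorEquivQuotSMul S C).toLinearMap ∘ₗ
      LinearMap.rTensor S (e.symm.toLinearMap ∘ₗ N.mkQ)
  have h := congrArg Ψ hs
  obtain ⟨a, b, rfl⟩ := hu s
  have h1 : N.mkQ (1 : S) = 0 := by
    rw [Submodule.mkQ_apply, Submodule.Quotient.mk_eq_zero]
    exact ⟨1, by simp⟩
  have h2 : N.mkQ (algebraMap A S a) = 0 := by
    rw [Submodule.mkQ_apply, Submodule.Quotient.mk_eq_zero]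
    exact ⟨a, rfl⟩
  have h3 : e.symm (b • N.mkQ u) = Ideal.Quotient.mk C b := by
    rw [LinearEquiv.symm_apply_eq]
    rfl
  have h4 : Ψ ((algebraMap A S a + b • u) ⊗ₜ[A] 1) =
      (Submodule.Quotient.mk (b • (1 : S)) : S ⧸ (C • (⊤ : Submodule A S))) := by
    have h2a : N.mkQ (algebraMap A S a + b • u) = b • N.mkQ u := by
      rw [map_add, h2, zero_add, map_smul]
    change (TensorProduct.quotTensorEquivQuotSMul S C)
      ((e.symm (N.mkQ (algebraMap A S a + b • u))) ⊗ₜ[A] 1) = _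
    rw [h2a, h3, TensorProduct.quotTensorEquivQuotSMul_mk_tmul]
  have h5 : Ψ (1 ⊗ₜ[A] (algebraMap A S a + b • u)) = 0 := by
    simp only [Ψ, LinearMap.comp_apply, LinearMap.rTensor_tmul, h1, map_zero, TensorProduct.zero_tmul]
  rw [h4, h5, Submodule.Quotient.mk_eq_zero] at h
  have h6 : ∀ z ∈ (C • (⊤ : Submodule A S)), z * u ∈ N := by
    intro z hz
    refine Submodule.smul_induction_on hz ?_ ?_
    · intro c hc t _
      obtain ⟨p, q, hpq⟩ := hu (t * u)
      rw [smul_mul_assoc, hpq, smul_add, smul_comm]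
      refine N.add_mem ⟨c * p, by simp [Algebra.smul_def]⟩ (N.smul_mem q ((hC c).1 hc))
    · intro z w hz hw
      rw [add_mul]
      exact N.add_mem hz hw
  have h7 := h6 _ h
  rw [smul_mul_assoc, one_mul] at h7
  obtain ⟨c, hc⟩ := h7
  refine ⟨a + c, ?_⟩
  rw [← hc]
  simp

variable {R : Type*} [CommRing R]

theorem T_decomp (x y : R) (f : R[X])
    (hf : f ∈ ReesAlg (Ideal.span {x ^ 3, x ^ 2 * y ^ 2, x * y ^ 4, y ^ 5})) :
    ∃ a ∈ ReesAlg (Ideal.span {x ^ 3, x * y ^ 4, y ^ 5}),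
    ∃ b ∈ ReesAlg (Ideal.span {x ^ 3, x * y ^ 4, y ^ 5}), f = a + b * (C (x ^ 2 * y ^ 2) * X) := by
  set A := ReesAlg (Ideal.span {x ^ 3, x * y ^ 4, y ^ 5}) with hA
  have hgen : ∀ a ∈ Ideal.span {x ^ 3, x * y ^ 4, y ^ 5}, C a * X ∈ A := fun a ha =>
    Algebra.subset_adjoin ⟨a, ha, rfl⟩
  have hu : (C (x ^ 2 * y ^ 2) * X) * (C (x ^ 2 * y ^ 2) * X) ∈ A := by
    have := A.mul_mem (hgen (x ^ 3) (Ideal.subset_span (by simp)))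
      (hgen (x * y ^ 4) (Ideal.subset_span (by simp)))
    convert this using 1
    simp only [C_mul, C_pow]
    ring
  rw [ReesAlg] at hf
  induction hf using Algebra.adjoin_induction with
  | mem f hf =>
    obtain ⟨a, ha, rfl⟩ := hf
    have h1 : a ∈ Ideal.span {x ^ 2 * y ^ 2} ⊔ Ideal.span {x ^ 3, x * y ^ 4, y ^ 5} := by
      rw [← Ideal.span_union]
      refine Ideal.span_mono ?_ ha
      intro z hz
      simp only [Set.mem_insert_iff, Set.mem_singleton_iff, Set.mem_union] at hz ⊢
      tauto
    obtain ⟨p, hp, q, hq, rfl⟩ := Submodule.mem_sup.1 h1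
    obtain ⟨r, rfl⟩ := Ideal.mem_span_singleton'.1 hp
    refine ⟨_, hgen q hq, C r, A.algebraMap_mem r, ?_⟩
    simp only [C_add, C_mul]
    ring
  | algebraMap r => exact ⟨_, A.algebraMap_mem r, 0, A.zero_mem, by simp⟩
  | add f g _ _ hf hg =>
    obtain ⟨a, ha, b, hb, rfl⟩ := hf
    obtain ⟨c, hc, d, hd, rfl⟩ := hg
    exact ⟨_, A.add_mem ha hc, _, A.add_mem hb hd, by ring⟩
  | mul f g _ _ hf hg =>
    obtain ⟨a, ha, b, hb, rfl⟩ := hf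
    obtain ⟨c, hc, d, hd, rfl⟩ := hg
    exact ⟨_, A.add_mem (A.mul_mem ha hc) (A.mul_mem (A.mul_mem hb hd) hu), _,
      A.add_mem (A.mul_mem ha hd) (A.mul_mem hb hc), by ring⟩

theorem I_le_J (x y : R) : Ideal.span {x ^ 3, x * y ^ 4, y ^ 5} ≤
    Ideal.span {x ^ 3, x ^ 2 * y ^ 2, x * y ^ 4, y ^ 5} := by
  apply Ideal.span_mono
  intro z hz
  simp only [Set.mem_insert_iff, Set.mem_singleton_iff] at hz ⊢
  tauto

theorem u_integral (x y : R) : IsIntegral (ReesAlg (Ideal.span {x ^ 3, x * y ^ 4, y ^ 5}))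
    (C (x ^ 2 * y ^ 2) * X : R[X]) := by
  apply IsIntegral.of_pow (n := 2) (by norm_num)
  have h1 : C (x ^ 3) * X ∈ ReesAlg (Ideal.span {x ^ 3, x * y ^ 4, y ^ 5}) :=
    Algebra.subset_adjoin ⟨x ^ 3, Ideal.subset_span (by simp), rfl⟩
  have h2 : C (x * y ^ 4) * X ∈ ReesAlg (Ideal.span {x ^ 3, x * y ^ 4, y ^ 5}) :=
    Algebra.subset_adjoin ⟨x * y ^ 4, Ideal.subset_span (by simp), rfl⟩
  have : (C (x ^ 2 * y ^ 2) * X : R[X]) ^ 2 = algebraMap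
    (ReesAlg (Ideal.span {x ^ 3, x * y ^ 4, y ^ 5})) R[X] ⟨_, mul_mem h1 h2⟩ := by
    change _ = (C (x ^ 3) * X) * (C (x * y ^ 4) * X)
    simp only [C_mul, C_pow]
    ring
  rw [this]
  exact isIntegral_algebraMap

theorem frac_of_rees [IsDomain R] (I : Ideal R) (z : R) (hz : z ∈ I) (hz0 : z ≠ 0)
    (K : Type*) [CommRing K] [Algebra R[X] K] [IsFractionRing R[X] K]
    (A : Subalgebra R R[X]) (hA : A = reesAlgebra I) [Algebra A K]
    (hmap : ∀ a : A, algebraMap A K a = algebraMap R[X] K (a : R[X])) :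
    IsFractionRing A K := by
  have hmul : ∀ (f : R[X]) (N : ℕ), f.natDegree ≤ N → C (z ^ N) * f ∈ A := by
    intro f N hN
    rw [hA, mem_reesAlgebra_iff]
    intro i
    rw [coeff_C_mul]
    by_cases hi : i ≤ f.natDegree
    · exact Ideal.mul_mem_right _ _ (Ideal.pow_le_pow_right (hi.trans hN) (Ideal.pow_mem_pow hz N))
    · rw [coeff_eq_zero_of_natDegree_lt (by omega)]
      simp
  have hinj := IsFractionRing.injective R[X] K
  unfold IsFractionRing
  rw [isLocalization_iff]
  refine ⟨?_, ?_, ?_⟩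
  · rintro ⟨a, ha⟩
    rw [hmap]
    refine IsLocalization.map_units K (⟨(a : R[X]), ?_⟩ : nonZeroDivisors R[X])
    rw [mem_nonZeroDivisors_iff_ne_zero] at ha ⊢
    simpa using ha
  · intro w
    obtain ⟨⟨f, s, hs⟩, h⟩ := IsLocalization.surj (nonZeroDivisors R[X]) w
    set N := max f.natDegree s.natDegree
    have h1 := hmul f N (le_max_left _ _)
    have h2 := hmul s N (le_max_right _ _)
    rw [mem_nonZeroDivisors_iff_ne_zero] at hs
    refine ⟨⟨⟨_, h1⟩, ⟨⟨_, h2⟩, ?_⟩⟩, ?_⟩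
    · rw [mem_nonZeroDivisors_iff_ne_zero]
      intro h3
      have h4 := congrArg Subtype.val h3
      simp [hs, hz0] at h4
    · rw [hmap, hmap]
      simp only [map_mul]
      simp only at h
      rw [← h]; ring
  · intro a b hab
    rw [hmap, hmap] at hab
    exact ⟨1, by rw [Subtype.ext (hinj hab)]⟩

theorem not_mem_I [IsDomain R] [IsLocalRing R] (x y : R)
    (hm : IsLocalRing.maximalIdeal R = Ideal.span {x, y}) (hx : Prime x) (hxy : ¬ x ∣ y) :
    x ^ 2 * y ^ 2 ∉ Ideal.span {x ^ 3, x * y ^ 4, y ^ 5} := by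
  intro h
  rw [Ideal.mem_span_insert] at h
  obtain ⟨a, w, hw, e⟩ := h
  obtain ⟨b, c, rfl⟩ := Ideal.mem_span_pair.1 hw
  have hxk : ∀ k, ¬ x ∣ y ^ k := fun k h => hxy (hx.dvd_of_dvd_pow h)
  obtain ⟨c', rfl⟩ := (hx.dvd_or_dvd (show x ∣ y ^ 5 * c from
    ⟨x * y ^ 2 - a * x ^ 2 - b * y ^ 4, by linear_combination -e⟩)).resolve_left (hxk 5)
  have e1 : x * y ^ 2 = a * x ^ 2 + b * y ^ 4 + c' * y ^ 5 := by
    apply mul_left_cancel₀ hx.ne_zero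
    linear_combination e
  obtain ⟨d, hd⟩ := (hx.dvd_or_dvd (show x ∣ y ^ 4 * (b + c' * y) from
    ⟨y ^ 2 - a * x, by linear_combination -e1⟩)).resolve_left (hxk 4)
  have e2 : y ^ 2 = a * x + d * y ^ 4 := by
    apply mul_left_cancel₀ hx.ne_zero
    linear_combination e1 + y ^ 4 * hd
  have h3 := (hx.dvd_or_dvd (show x ∣ y ^ 2 * (1 - d * y ^ 2) from
    ⟨a, by linear_combination e2⟩)).resolve_left (hxk 2)
  have hym : y ∈ IsLocalRing.maximalIdeal R := by rw [hm]; exact Ideal.subset_span (by simp)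
  have hxm : x ∈ IsLocalRing.maximalIdeal R := by rw [hm]; exact Ideal.subset_span (by simp)
  have h5 := (IsLocalRing.maximalIdeal R).mem_of_dvd h3 hxm
  have h6 : (1 : R) ∈ IsLocalRing.maximalIdeal R := by
    have := Ideal.add_mem _ h5 (Ideal.mul_mem_left _ (d * y) hym)
    convert this using 1; ring
  exact h6 isUnit_one

theorem main_aux [IsNoetherianRing R] [IsLocalRing R]
    (hdim : ringKrullDim R = 2) (x y : R)
    (hm : IsLocalRing.maximalIdeal R = Ideal.span {x, y})
    (K : Type*) [CommRing K] [Algebra R[X] K] [IsFractionRing R[X] K]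
    (A T : Subalgebra R R[X])
    (hA : A = ReesAlg (Ideal.span {x ^ 3, x * y ^ 4, y ^ 5}))
    (hT : T = ReesAlg (Ideal.span {x ^ 3, x ^ 2 * y ^ 2, x * y ^ 4, y ^ 5}))
    [Algebra A K]
    (hmap : ∀ a : A, algebraMap A K a = algebraMap R[X] K (a : R[X])) :
    (IsFractionRing A K ∧
       (integralClosure A K : Set K) = algebraMap R[X] K '' (T : Set R[X]) ∧
       IsStrictlyClosedIn A (integralClosure A K)) ∧ A ≠ T := by
  have := R_domain hdim x y hm
  have hxp := x_prime hdim x y hm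
  have := R_normal hdim x y hm
  have hxy : ¬ x ∣ y := by simpa using y_pow_not hdim x y hm 1
  have hinj := IsFractionRing.injective R[X] K
  have tower := IsScalarTower.of_algebraMap_eq (R := A) (S := R[X]) (A := K) hmap
  have hAG : ∀ a ∈ A, WG x y 0 a := by
    intro a ha i
    rw [hA, ReesAlg_eq, mem_reesAlgebra_iff] at ha
    have := pow_le_WF x y i (ha i)
    rwa [show (0 + 15 * (i : ℤ)).toNat = 15 * i by omega]
  have hu : IsIntegral A (C (x ^ 2 * y ^ 2) * X : R[X]) := by
    subst hA; exact u_integral x y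
  have hTI : ∀ f ∈ T, IsIntegral A f := by
    intro f hf
    rw [hT] at hf
    obtain ⟨a, ha, b, hb, rfl⟩ := T_decomp x y f hf
    rw [← hA] at ha hb
    exact (isIntegral_algebraMap (x := (⟨a, ha⟩ : A))).add
      ((isIntegral_algebraMap (x := (⟨b, hb⟩ : A))).mul hu)
  have hset : (integralClosure A K : Set K) = algebraMap R[X] K '' (T : Set R[X]) := by
    ext z
    constructor
    · intro hz
      have hz : IsIntegral A z := hz
      obtain ⟨f, rfl⟩ := IsIntegrallyClosed.isIntegral_iff.1 (hz.tower_top (A := R[X]))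
      have hf : IsIntegral A f := (isIntegral_algebraMap_iff hinj).1 hz
      refine ⟨f, ?_, rfl⟩
      have := WG_integral hm hxp hxy A hAG f hf
      rw [SetLike.mem_coe, hT, ReesAlg_eq, mem_reesAlgebra_iff]
      intro i
      apply WF_le_pow x y i
      have h1 := this i
      rwa [show (0 + 15 * (i : ℤ)).toNat = 15 * i by omega] at h1
    · rintro ⟨f, hf, rfl⟩
      exact (hTI f hf).algebraMap
  refine ⟨⟨?_, hset, ?_⟩, ?_⟩
  · exact frac_of_rees _ (x ^ 3) (Ideal.subset_span (by simp)) (pow_ne_zero 3 hxp.ne_zero) K A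
      (hA.trans (ReesAlg_eq _)) hmap
  · refine strict_of_cyclic A _ (⟨algebraMap R[X] K (C (x ^ 2 * y ^ 2) * X), hu.algebraMap⟩ :
      integralClosure A K) ?_
    rintro ⟨s, hs⟩
    have hs' : s ∈ (integralClosure A K : Set K) := hs
    rw [hset] at hs'
    obtain ⟨f, hf, rfl⟩ := hs'
    rw [SetLike.mem_coe, hT] at hf
    obtain ⟨a, ha, b, hb, rfl⟩ := T_decomp x y f hf
    rw [← hA] at ha hb
    refine ⟨⟨a, ha⟩, ⟨b, hb⟩, ?_⟩
    apply Subtype.ext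
    rw [Algebra.smul_def]
    change algebraMap R[X] K _ = algebraMap A K ⟨a, ha⟩ + algebraMap A K ⟨b, hb⟩ *
      algebraMap R[X] K (C (x ^ 2 * y ^ 2) * X)
    rw [hmap, hmap, map_add, map_mul (algebraMap R[X] K) b]
  · intro hAT
    have h1 : (C (x ^ 2 * y ^ 2) * X : R[X]) ∈ T := by
      rw [hT]
      exact Algebra.subset_adjoin ⟨_, Ideal.subset_span (by simp), rfl⟩
    rw [← hAT, hA, ReesAlg_eq, mem_reesAlgebra_iff] at h1
    have h2 := h1 1
    rw [pow_one, coeff_C_mul_X] at h2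
    exact not_mem_I x y hm hxp hxy (by simpa using h2)

end Part3

set_option synthInstance.maxHeartbeats 1000000 in
set_option maxHeartbeats 1000000 in
/-- Let `(R, 𝔪)` be a two-dimensional regular local ring with `𝔪 = (x, y)`
(encoded: `R` Noetherian local with `ringKrullDim R = 2` and `𝔪 = (x, y)`).  Let
`I = (x³, xy⁴, y⁵)`, `J = (x³, x²y², xy⁴, y⁵)`, `𝓡 = R[It]` and `𝓣 = R[Jt]` inside `R[t]`.
Then, `K` denoting the total ring of fractions of `R[t]`, `K` is also the total ring of
fractions of `𝓡`, the integral closure of `𝓡` in `K` equals `𝓣 = R[Jt]`, `𝓡` is strictly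
closed (in this integral closure), and `𝓡 ≠ R[Jt]`, i.e. `𝓡` is not integrally closed. -/
theorem reesAlgebra_of_x3_xy4_y5_strictlyClosed
    (R : Type*) [CommRing R] [IsNoetherianRing R] [IsLocalRing R]
    (hdim : ringKrullDim R = 2) (x y : R)
    (hm : IsLocalRing.maximalIdeal R = Ideal.span {x, y})
    (K : Type*) [CommRing K] [Algebra (Polynomial R) K]
    [IsFractionRing (Polynomial R) K]
    (𝓡 𝓣 : Subalgebra R (Polynomial R))
    (h𝓡 : 𝓡 = ReesAlg (Ideal.span {x ^ 3, x * y ^ 4, y ^ 5}))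
    (h𝓣 : 𝓣 = ReesAlg (Ideal.span {x ^ 3, x ^ 2 * y ^ 2, x * y ^ 4, y ^ 5})) :
    (letI : Algebra 𝓡 K := ((algebraMap (Polynomial R) K).comp 𝓡.val.toRingHom).toAlgebra
     IsFractionRing 𝓡 K ∧
       (integralClosure 𝓡 K : Set K) = algebraMap (Polynomial R) K '' (𝓣 : Set (Polynomial R)) ∧
       IsStrictlyClosedIn 𝓡 (integralClosure 𝓡 K)) ∧
    𝓡 ≠ 𝓣 := by

  letI : Algebra 𝓡 K := ((algebraMap (Polynomial R) K).comp 𝓡.val.toRingHom).toAlgebra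
  exact main_aux hdim x y hm K 𝓡 𝓣 h𝓡 h𝓣 (fun _ => rfl)
end

section
/- Let S = k[X, Y] be the polynomial ring over a field k, let n ≥ 3 be an integer, and set R = k[X^{n-i}Y^i : 0 ≤ i ≤ n, i ≠ 1] ⊆ S. Then R is strictly closed, X^n, Y^n form a regular sequence on R, and R is a Cohen-Macaulay ring of Krull dimension 2. -/
open scoped TensorProduct

open MvPolynomial

/-- A (Noetherian) ring is Cohen–Macaulay if, for every maximal ideal `M`, the localization
`R_M` admits a regular sequence contained in its maximal ideal whose length equals its Krull
dimension (i.e. depth `R_M` = dim `R_M`). -/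
def IsCohenMacaulayRing (R : Type*) [CommRing R] : Prop :=
  ∀ (M : Ideal R) [M.IsMaximal],
    ∃ s : List (Localization.AtPrime M),
      (∀ a ∈ s, a ∈ IsLocalRing.maximalIdeal (Localization.AtPrime M)) ∧
      RingTheory.Sequence.IsRegular (Localization.AtPrime M) s ∧
      (s.length : WithBot ℕ∞) = ringKrullDim (Localization.AtPrime M)

/-- `R = k[Xⁿ⁻ⁱYⁱ : 0 ≤ i ≤ n, i ≠ 1]` inside `S = k[X, Y]`. -/
noncomputable def veroneseMinus (k : Type*) [Field k] (n : ℕ) :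
    Subalgebra k (MvPolynomial (Fin 2) k) :=
  Algebra.adjoin k {p | ∃ i ≤ n, i ≠ 1 ∧ p = X 0 ^ (n - i) * X 1 ^ i}


namespace VM
variable {k : Type*} [Field k] {n : ℕ}

lemma mon_mem (hn : 3 ≤ n) (d : ℕ) : ∀ a b : ℕ, a + b = n * d → b ≠ 1 →
    (X 0 ^ a * X 1 ^ b : MvPolynomial (Fin 2) k) ∈ veroneseMinus k n := by
  induction d with
  | zero =>
    intro a b h _
    obtain ⟨rfl, rfl⟩ : a = 0 ∧ b = 0 := by simpa using h
    simp
  | succ d ih =>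
    intro a b h hb
    have key : ∃ i, i ≤ n ∧ i ≠ 1 ∧ i ≤ b ∧ n - i ≤ a ∧ b - i ≠ 1 := by
      rw [Nat.mul_succ] at h
      rcases Nat.eq_zero_or_pos b with h0 | h0
      · exact ⟨0, by omega, by omega, by omega, by omega, by omega⟩
      rcases le_or_gt b n with h1 | h1
      · exact ⟨b, by omega, by omega, by omega, by omega, by omega⟩
      by_cases h2 : b = n + 1
      · refine ⟨n - 1, by omega, by omega, by omega, ?_, by omega⟩
        rcases Nat.eq_zero_or_pos d with rfl | hd
        · omega
        · have : n * 1 ≤ n * d := Nat.mul_le_mul_left n hd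
          omega
      · exact ⟨n, by omega, by omega, by omega, by omega, by omega⟩
    obtain ⟨i, h1, h2, h3, h4, h5⟩ := key
    have e : (X 0 ^ a * X 1 ^ b : MvPolynomial (Fin 2) k) =
        (X 0 ^ (n - i) * X 1 ^ i) * (X 0 ^ (a - (n - i)) * X 1 ^ (b - i)) := by
      conv_lhs => rw [← Nat.add_sub_cancel' h4, ← Nat.add_sub_cancel' h3]
      rw [pow_add, pow_add]; ring
    rw [e]
    refine mul_mem (Algebra.subset_adjoin ⟨i, h1, h2, rfl⟩) (ih _ _ ?_ h5)
    rw [Nat.mul_succ] at h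
    omega

lemma supp_of_mem {f : MvPolynomial (Fin 2) k} (hf : f ∈ veroneseMinus k n) :
    ∀ m ∈ f.support, n ∣ m 0 + m 1 ∧ m 1 ≠ 1 := by
  classical
  induction hf using Algebra.adjoin_induction with
  | mem p hp =>
    obtain ⟨i, hi, h1, rfl⟩ := hp
    intro m hm
    have : (X 0 ^ (n - i) * X 1 ^ i : MvPolynomial (Fin 2) k) =
        monomial (Finsupp.single 0 (n - i) + Finsupp.single 1 i) 1 := by
      simp [X_pow_eq_monomial, monomial_mul]
    rw [this] at hm
    have := Finset.mem_singleton.1 (support_monomial_subset hm)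
    subst this
    simp [h1, Nat.sub_add_cancel hi]
  | algebraMap r =>
    intro m hm
    have : m = 0 := by
      have := support_monomial_subset (s := 0) (a := r) hm
      simpa using this
    subst this
    simp
  | add x y _ _ hx hy =>
    intro m hm
    rcases Finset.mem_union.1 (support_add hm) with h | h
    · exact hx m h
    · exact hy m h
  | mul x y _ _ hx hy =>
    intro m hm
    obtain ⟨a, ha, b, hb, rfl⟩ := Finset.mem_add.1 (support_mul x y hm)
    obtain ⟨h1, h2⟩ := hx a ha
    obtain ⟨h3, h4⟩ := hy b hb
    refine ⟨?_, ?_⟩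
    · have := dvd_add h1 h3
      rw [Finsupp.add_apply, Finsupp.add_apply, add_add_add_comm]
      exact this
    · simp only [Finsupp.add_apply]; omega

lemma mem_of_supp (hn : 3 ≤ n) {f : MvPolynomial (Fin 2) k}
    (h : ∀ m ∈ f.support, n ∣ m 0 + m 1 ∧ m 1 ≠ 1) : f ∈ veroneseMinus k n := by
  rw [f.as_sum]
  refine sum_mem fun m hm => ?_
  obtain ⟨⟨d, hd⟩, h1⟩ := h m hm
  have : monomial m (coeff m f) = coeff m f • (X 0 ^ m 0 * X 1 ^ m 1 : MvPolynomial (Fin 2) k) := by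
    rw [monomial_eq, Finsupp.prod_fintype _ _ (by simp), Fin.prod_univ_two, smul_eq_C_mul]
  rw [this]
  exact Subalgebra.smul_mem _ (mon_mem hn d _ _ hd h1) _

/-- setting `Y = 0` -/
noncomputable def th (k : Type*) [Field k] : MvPolynomial (Fin 2) k →ₐ[k] MvPolynomial (Fin 2) k :=
  aeval ![X 0, 0]

/-- the `Y`-derivative at `Y = 0` -/
noncomputable def D (f : MvPolynomial (Fin 2) k) : MvPolynomial (Fin 2) k := th k (pderiv 1 f)

lemma coeff_th (f : MvPolynomial (Fin 2) k) (m : Fin 2 →₀ ℕ) (hm : m 1 = 0) :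
    coeff m (th k f) = coeff m f := by
  classical
  induction f using MvPolynomial.induction_on' with
  | add p q hp hq => simp [hp, hq]
  | monomial s c =>
    rw [th, aeval_monomial, Finsupp.prod_fintype _ _ (by simp), Fin.prod_univ_two]
    by_cases h : s 1 = 0
    · have : (monomial s c : MvPolynomial (Fin 2) k) = C c * (X 0 ^ s 0) := by
        rw [monomial_eq, Finsupp.prod_fintype _ _ (by simp), Fin.prod_univ_two, h]; simp
      simp [h, this, MvPolynomial.algebraMap_eq]
    · have : s ≠ m := by rintro rfl; exact h hm
      simp [h, coeff_monomial, this]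

lemma D_add (f g : MvPolynomial (Fin 2) k) : D (f + g) = D f + D g := by simp [D]

lemma D_mul (f g : MvPolynomial (Fin 2) k) : D (f * g) = th k f * D g + D f * th k g := by
  simp [D]; ring

lemma coeff_of_D {f : MvPolynomial (Fin 2) k} (h : D f = 0) (m : Fin 2 →₀ ℕ) (hm : m 1 = 1) :
    coeff m f = 0 := by
  obtain ⟨m', rfl⟩ : ∃ m', m = m' + Finsupp.single 1 1 := 
    ⟨m - Finsupp.single 1 1, by rw [tsub_add_cancel_of_le]; simp [hm]⟩
  have h0 : m' 1 = 0 := by simpa using hm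
  have := congrArg (coeff m') h
  rw [D, coeff_th _ _ h0, coeff_pderiv, h0] at this
  simpa using this

lemma coeff_th' (f : MvPolynomial (Fin 2) k) (m : Fin 2 →₀ ℕ) (hm : m 1 ≠ 0) :
    coeff m (th k f) = 0 := by
  classical
  induction f using MvPolynomial.induction_on' with
  | add p q hp hq => simp [hp, hq]
  | monomial s c =>
    rw [th, aeval_monomial, Finsupp.prod_fintype _ _ (by simp), Fin.prod_univ_two]
    by_cases h : s 1 = 0
    · have : (Finsupp.single 0 (s 0) : Fin 2 →₀ ℕ) ≠ m := by rintro rfl; simp at hm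
      simp [h, MvPolynomial.algebraMap_eq, coeff_X_pow, this]
    · simp [h]

lemma D_of_mem {f : MvPolynomial (Fin 2) k} (hf : f ∈ veroneseMinus k n) : D f = 0 := by
  ext m
  by_cases hm : m 1 = 0
  · rw [D, coeff_th _ _ hm, coeff_pderiv]
    have : coeff (m + Finsupp.single 1 1) f = 0 := by
      by_contra h
      have := (supp_of_mem hf _ (mem_support_iff.2 h)).2
      simp [hm] at this
    simp [this]
  · rw [D, coeff_th' _ _ hm]; simp

lemma th_ne {f : MvPolynomial (Fin 2) k} (h : f.degreeOf 1 = 0) : th k f = f := by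
  ext m
  by_cases hm : m 1 = 0
  · exact coeff_th _ _ hm
  · rw [coeff_th' _ _ hm]
    by_contra h'
    have := monomial_le_degreeOf 1 (mem_support_iff.2 (Ne.symm h'))
    omega

/-- degree-divisible-by-`n` polynomials -/
abbrev gr (k : Type*) [Field k] (n : ℕ) : ZMod n → Submodule k (MvPolynomial (Fin 2) k) :=
  weightedHomogeneousSubmodule k (fun _ : Fin 2 => (1 : ZMod n))

lemma mem_gr (f : MvPolynomial (Fin 2) k) :
    f ∈ gr k n 0 ↔ ∀ m ∈ f.support, n ∣ m 0 + m 1 := by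
  rw [mem_weightedHomogeneousSubmodule, IsWeightedHomogeneous]
  have : ∀ m : Fin 2 →₀ ℕ, Finsupp.weight (fun _ : Fin 2 => (1 : ZMod n)) m = 0 ↔ n ∣ m 0 + m 1 := by
    intro m
    rw [Finsupp.weight_apply, Finsupp.sum_fintype _ _ (by simp), Fin.sum_univ_two,
      ← ZMod.natCast_eq_zero_iff]
    simp
  simp [this, mem_support_iff]

lemma gr_div {f h : MvPolynomial (Fin 2) k} (hf : f ∈ gr k n 0) (h0 : f ≠ 0)
    (hu : f * h ∈ gr k n 0) : h ∈ gr k n 0 := by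
  classical
  let : GradedAlgebra (gr k n) := weightedGradedAlgebra k (fun _ : Fin 2 => (1 : ZMod n))
  have e := DirectSum.coe_decompose_mul_of_left_mem_zero (gr k n) (b := h) hf (j := 0)
  rw [DirectSum.decompose_of_mem_same _ hu] at e
  rw [mul_left_cancel₀ h0 e]
  exact SetLike.coe_mem _

lemma mem_gr_of_mem {f : MvPolynomial (Fin 2) k} (hf : f ∈ veroneseMinus k n) : f ∈ gr k n 0 :=
  (mem_gr f).2 fun m hm => (supp_of_mem hf m hm).1

lemma mem_of_gr_D (hn : 3 ≤ n) {f : MvPolynomial (Fin 2) k} (hf : f ∈ gr k n 0) (hD : D f = 0) :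
    f ∈ veroneseMinus k n :=
  mem_of_supp hn fun m hm => ⟨(mem_gr f).1 hf m hm, fun h =>
    (mem_support_iff.1 hm) (coeff_of_D hD m h)⟩

/-- division inside `R` by a polynomial in `X` -/
lemma div_mem (hn : 3 ≤ n) {f h : MvPolynomial (Fin 2) k} (hf : f ∈ veroneseMinus k n)
    (h0 : f ≠ 0) (hdeg : f.degreeOf 1 = 0) (hu : f * h ∈ veroneseMinus k n) :
    h ∈ veroneseMinus k n := by
  refine mem_of_gr_D hn (gr_div (mem_gr_of_mem hf) h0 (mem_gr_of_mem hu)) ?_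
  have := D_of_mem hu
  rw [D_mul, D_of_mem hf, zero_mul, add_zero, th_ne hdeg] at this
  exact (mul_eq_zero.1 this).resolve_left h0

lemma degreeOf_aeval {i j : Fin 2} (hij : i ≠ j) (f : Polynomial k) :
    (Polynomial.aeval (X i ^ n : MvPolynomial (Fin 2) k) f).degreeOf j = 0 := by
  have hp : ∀ d, ((X i ^ n : MvPolynomial (Fin 2) k) ^ d).degreeOf j = 0 := by
    intro d
    rw [← pow_mul]
    refine Nat.le_zero.1 ((degreeOf_pow_le _ _ _).trans ?_)
    rw [degreeOf_X_of_ne (by exact hij.symm)]; simp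
  induction f using Polynomial.induction_on' with
  | add p q hp hq =>
    rw [map_add]
    refine Nat.le_zero.1 ((degreeOf_add_le _ _ _).trans ?_)
    simp [hp, hq]
  | monomial d c =>
    rw [Polynomial.aeval_monomial, MvPolynomial.algebraMap_eq]
    exact Nat.le_zero.1 ((degreeOf_C_mul_le _ _ _).trans (hp d).le)

lemma aeval_ne (hn : 3 ≤ n) (i : Fin 2) {f : Polynomial k} (hf : f ≠ 0) :
    Polynomial.aeval (X i ^ n : MvPolynomial (Fin 2) k) f ≠ 0 := by
  have : Transcendental k (X i ^ n : MvPolynomial (Fin 2) k) :=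
    (transcendental_X k i).pow (by omega)
  exact fun h => hf (transcendental_iff.1 this f h)

lemma relPrime {p q : MvPolynomial (Fin 2) k} (hp : p ≠ 0) (hq : q ≠ 0)
    (h1 : p.degreeOf 1 = 0) (h2 : q.degreeOf 0 = 0) : IsRelPrime p q := by
  rintro d ⟨a, rfl⟩ ⟨b, rfl⟩
  have hd := left_ne_zero_of_mul hp
  rw [degreeOf_mul_eq hd (right_ne_zero_of_mul hp)] at h1
  rw [degreeOf_mul_eq hd (right_ne_zero_of_mul hq)] at h2
  have ht : d.totalDegree = 0 := by
    rw [totalDegree_eq_zero_iff]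
    intro m hm x
    have := monomial_le_degreeOf x hm
    fin_cases x
    · simp at this ⊢; omega
    · simp at this ⊢; omega
  rw [totalDegree_eq_zero_iff_eq_C] at ht
  rw [ht] at hd ⊢
  refine (IsUnit.mk0 _ ?_).map C
  intro h; rw [h] at hd; simp at hd

end VM

namespace VM
variable {k : Type*} [Field k] {n : ℕ}

lemma weaklyRegular_pair {R : Type*} [CommRing R] [IsDomain R] {p q : R} (hp : p ≠ 0)
    (h : ∀ u v, p * v = q * u → ∃ h, u = p * h) :
    RingTheory.Sequence.IsWeaklyRegular R [p, q] := by
  refine .cons ?_ (.cons ?_ (.nil _ _))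
  · intro a b hab
    exact mul_left_cancel₀ hp hab
  · rw [isSMulRegular_iff_right_eq_zero_of_smul]
    intro m
    obtain ⟨u, rfl⟩ := Submodule.Quotient.mk_surjective _ m
    rw [← Submodule.Quotient.mk_smul, Submodule.Quotient.mk_eq_zero,
      Submodule.Quotient.mk_eq_zero, Submodule.mem_smul_pointwise_iff_exists,
      Submodule.mem_smul_pointwise_iff_exists]
    rintro ⟨v, -, hv⟩
    obtain ⟨w, hw⟩ := h u v hv
    exact ⟨w, trivial, hw.symm⟩

lemma local_data_aux {R : Type*} [CommRing R] [IsNoetherianRing R] {p q : R} {M : Ideal R}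
    [M.IsMaximal] (hw : RingTheory.Sequence.IsWeaklyRegular R [p, q]) (hpM : p ∈ M) (hqM : q ∈ M)
    (hmin : M ∈ (Ideal.span {p, q}).minimalPrimes) :
    ∃ s : List (Localization.AtPrime M), s.length = 2 ∧
      (∀ a ∈ s, a ∈ IsLocalRing.maximalIdeal (Localization.AtPrime M)) ∧
      RingTheory.Sequence.IsRegular (Localization.AtPrime M) s ∧
      M.height = 2 := by
  have hr := hw.isRegular_of_isLocalization_of_mem (Localization.AtPrime M) M
    (by simp [hpM, hqM])
  generalize hl : [p, q].map (algebraMap R (Localization.AtPrime M)) = l at hr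
  have hlen : l.length = 2 := by simp [← hl]
  refine ⟨l, hlen, ?_, hr, ?_⟩
  · intro a ha
    rw [← hl] at ha
    obtain ⟨r, hr, rfl⟩ := List.mem_map.1 ha
    rw [IsLocalization.AtPrime.to_map_mem_maximal_iff _ M]
    simp only [List.mem_cons, List.not_mem_nil, or_false] at hr
    rcases hr with rfl | rfl <;> assumption
  · apply le_antisymm
    · refine (Ideal.height_le_card_of_mem_minimalPrimes_span (by simp) hmin).trans ?_
      exact_mod_cast (Set.ncard_insert_le p {q}).trans (by simp)
    · have h := ringKrullDim_add_length_eq_ringKrullDim_of_isRegular _ hr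
      rw [IsLocalization.AtPrime.ringKrullDim_eq_height M (Localization.AtPrime M), hlen] at h
      have hne : Nontrivial (Localization.AtPrime M ⧸ Ideal.ofList l) := by
        refine Ideal.Quotient.nontrivial_iff.2 fun h' => hr.2 ?_
        rw [h']; simp
      have h0 := ringKrullDim_nonneg_of_nontrivial (R := Localization.AtPrime M ⧸ Ideal.ofList l)
      have h2 : ((2 : ℕ∞) : WithBot ℕ∞) ≤ (M.height : WithBot ℕ∞) := by
        rw [← h]
        simpa using add_le_add_left h0 2
      exact WithBot.coe_le_coe.1 h2

lemma strictlyClosed_aux {R S T : Type*} [CommRing R] [IsDomain R] [CommRing S] [IsDomain S]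
    [IsIntegrallyClosed S] [CommRing T] (ι : R →+* S) (hι : Function.Injective ι)
    (d : S →+ T) (t : S →+* T) (hd : ∀ r s, d (ι r * s) = t (ι r) * d s) (hd1 : d 1 = 0)
    (hmem : ∀ s, d s = 0 → (∃ a b, b ≠ 0 ∧ ι b * s = ι a) → ∃ r, ι r = s) :
    IsStrictlyClosed R := by
  let K := FractionRing R
  let L := FractionRing S
  let j : R →+* L := (algebraMap S L).comp ι
  have hj : Function.Injective j := (IsFractionRing.injective S L).comp hι
  let ψ : K →+* L := IsFractionRing.lift (A := R) hj
  have hψ : ∀ r : R, ψ (algebraMap R K r) = algebraMap S L (ι r) :=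
    fun r => IsFractionRing.lift_algebraMap hj r
  have hint : ∀ s : integralClosure R K, ∃ t : S, algebraMap S L t = ψ s := by
    rintro ⟨s, p, hp, hs⟩
    refine IsIntegrallyClosed.isIntegral_iff.1 ⟨p.map ι, hp.map _, ?_⟩
    have := congrArg ψ hs
    rw [Polynomial.hom_eval₂, map_zero] at this
    rw [Polynomial.eval₂_map, ← this]
    congr 1
    ext r
    exact (hψ r).symm
  choose Φ hΦ using hint
  have Linj := IsFractionRing.injective S L
  have hadd : ∀ a b, Φ (a + b) = Φ a + Φ b := fun a b => Linj (by simp [hΦ])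
  have hsmul : ∀ (r : R) a, Φ (r • a) = ι r * Φ a := fun r a => Linj (by
    rw [map_mul, hΦ, hΦ, ← hψ, ← map_mul]; congr 1; exact Algebra.smul_def _ _)
  have hone : Φ 1 = 1 := Linj (by simp [hΦ])
  let β : integralClosure R K →+ integralClosure R K →+ T :=
    AddMonoidHom.mk' (fun a => AddMonoidHom.mk' (fun b => d (Φ a) * t (Φ b))
      (fun b c => by simp [hadd, mul_add]))
      (fun a b => by ext c; simp [hadd, add_mul])
  have hβ : ∀ (r : R) a b, β (r • a) b = β a (r • b) := by
    intro r a b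
    change d (Φ (r • a)) * t (Φ b) = d (Φ a) * t (Φ (r • b))
    rw [hsmul, hsmul, hd, map_mul]
    ring
  intro s hs
  have h1 := congrArg (TensorProduct.liftAddHom β hβ) hs
  rw [TensorProduct.liftAddHom_tmul, TensorProduct.liftAddHom_tmul] at h1
  change d (Φ s) * t (Φ 1) = d (Φ 1) * t (Φ s) at h1
  rw [hone, hd1, map_one, mul_one, zero_mul] at h1
  obtain ⟨⟨a, b⟩, hab⟩ := IsLocalization.surj (nonZeroDivisors R) (s : K)
  obtain ⟨r, hr⟩ := hmem (Φ s) h1 ⟨a, b, nonZeroDivisors.coe_ne_zero b, Linj (by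
      rw [map_mul, hΦ, ← hψ, ← hψ, ← map_mul, mul_comm]; exact congrArg ψ hab)⟩
  refine ⟨r, Subtype.ext (ψ.injective ?_)⟩
  rw [← hΦ s, ← hr]
  exact hψ r

lemma coe_aeval (x : veroneseMinus k n) (f : Polynomial k) :
    ((Polynomial.aeval x f : veroneseMinus k n) : MvPolynomial (Fin 2) k) =
      Polynomial.aeval (x : MvPolynomial (Fin 2) k) f := by
  exact (Polynomial.aeval_algHom_apply (veroneseMinus k n).val x f).symm

lemma weaklyRegular (hn : 3 ≤ n)
    (hXn : X 0 ^ n ∈ veroneseMinus k n) (hYn : X 1 ^ n ∈ veroneseMinus k n)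
    {f g : Polynomial k} (hf : f ≠ 0) (hg : g ≠ 0) :
    RingTheory.Sequence.IsWeaklyRegular (veroneseMinus k n)
      [Polynomial.aeval (⟨X 0 ^ n, hXn⟩ : veroneseMinus k n) f,
       Polynomial.aeval (⟨X 1 ^ n, hYn⟩ : veroneseMinus k n) g] := by
  set p := Polynomial.aeval (⟨X 0 ^ n, hXn⟩ : veroneseMinus k n) f with hp
  set q := Polynomial.aeval (⟨X 1 ^ n, hYn⟩ : veroneseMinus k n) g with hq
  have p0 : (p : MvPolynomial (Fin 2) k) ≠ 0 := by
    rw [hp, coe_aeval]; exact aeval_ne hn 0 hf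
  have q0 : (q : MvPolynomial (Fin 2) k) ≠ 0 := by
    rw [hq, coe_aeval]; exact aeval_ne hn 1 hg
  have pd : (p : MvPolynomial (Fin 2) k).degreeOf 1 = 0 := by
    rw [hp, coe_aeval]; exact degreeOf_aeval (by decide) f
  have qd : (q : MvPolynomial (Fin 2) k).degreeOf 0 = 0 := by
    rw [hq, coe_aeval]; exact degreeOf_aeval (by decide) g
  have hrel := relPrime p0 q0 pd qd
  have p0' : p ≠ 0 := fun h => p0 (by rw [h]; rfl)
  refine weaklyRegular_pair p0' ?_
  intro u v hv
  have hv' : (p : MvPolynomial (Fin 2) k) * v = q * u := congrArg Subtype.val hv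
  obtain ⟨h, hh⟩ := hrel.dvd_of_dvd_mul_left ⟨_, hv'.symm⟩
  exact ⟨⟨h, div_mem hn p.2 p0 pd (hh ▸ u.2)⟩, Subtype.ext hh⟩

instance fin : Algebra.FiniteType k (veroneseMinus k n) := by
  refine (veroneseMinus k n).fg_iff_finiteType.1 ?_
  refine Subalgebra.fg_def.2 ⟨_, ?_, rfl⟩
  refine ((Set.finite_Iic n).image
    fun i => (X 0 ^ (n - i) * X 1 ^ i : MvPolynomial (Fin 2) k)).subset ?_
  rintro p ⟨i, hi, -, rfl⟩
  exact ⟨i, hi, rfl⟩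

lemma regularXY (hn : 3 ≤ n)
    (hXn : X 0 ^ n ∈ veroneseMinus k n) (hYn : X 1 ^ n ∈ veroneseMinus k n) :
    RingTheory.Sequence.IsRegular (veroneseMinus k n)
      [(⟨X 0 ^ n, hXn⟩ : veroneseMinus k n), (⟨X 1 ^ n, hYn⟩ : veroneseMinus k n)] := by
  refine ⟨?_, ?_⟩
  · simpa using weaklyRegular hn hXn hYn (Polynomial.X_ne_zero (R := k)) Polynomial.X_ne_zero
  · intro h
    let φ : veroneseMinus k n →+* k := (constantCoeff).comp (veroneseMinus k n).val.toRingHom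
    have h1 : (1 : veroneseMinus k n) ∈ RingHom.ker φ := by
      have hle : Ideal.ofList [(⟨X 0 ^ n, hXn⟩ : veroneseMinus k n), ⟨X 1 ^ n, hYn⟩] ≤
          RingHom.ker φ := by
        refine Ideal.span_le.2 ?_
        have : n ≠ 0 := by omega
        rintro x hx
        simp only [List.mem_cons, List.not_mem_nil, or_false, Set.mem_ofPred_eq] at hx
        rcases hx with rfl | rfl <;> simp [RingHom.mem_ker, φ, this]
      apply hle
      have : (1 : veroneseMinus k n) ∈ (⊤ : Ideal (veroneseMinus k n)) := trivial
      rw [h] at this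
      simpa using this
    simp [RingHom.mem_ker] at h1

lemma integral_of_hom (hn : 3 ≤ n)
    (hXn : X 0 ^ n ∈ veroneseMinus k n) (hYn : X 1 ^ n ∈ veroneseMinus k n)
    {B : Type*} [CommRing B] [Algebra k B] (φ : veroneseMinus k n →ₐ[k] B)
    (hx : IsIntegral k (φ ⟨X 0 ^ n, hXn⟩)) (hy : IsIntegral k (φ ⟨X 1 ^ n, hYn⟩))
    (r : MvPolynomial (Fin 2) k) (hr : r ∈ veroneseMinus k n) : IsIntegral k (φ ⟨r, hr⟩) := by
  induction hr using Algebra.adjoin_induction with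
  | mem p hp =>
    have hp' := hp
    obtain ⟨i, hi, h1, rfl⟩ := hp'
    refine IsIntegral.of_pow (n := n) (by omega) ?_
    have e : (⟨X 0 ^ (n - i) * X 1 ^ i, Algebra.subset_adjoin hp⟩ : veroneseMinus k n) ^ n =
        (⟨X 0 ^ n, hXn⟩ : veroneseMinus k n) ^ (n - i) *
          (⟨X 1 ^ n, hYn⟩ : veroneseMinus k n) ^ i := by
      apply Subtype.ext
      change (X 0 ^ (n - i) * X 1 ^ i : MvPolynomial (Fin 2) k) ^ n =
        (X 0 ^ n) ^ (n - i) * (X 1 ^ n) ^ i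
      ring
    have e' := congrArg φ e
    rw [map_mul, map_pow, map_pow, map_pow] at e'
    have h := (hx.pow (n - i)).mul (hy.pow i)
    rw [← e'] at h
    exact h
  | algebraMap r =>
    have : φ (algebraMap k (veroneseMinus k n) r) = algebraMap k B r := φ.commutes r
    have h := isIntegral_algebraMap (R := k) (A := B) (x := r)
    rw [← this] at h
    exact h
  | add x y hx hy h1 h2 =>
    have := h1.add h2
    rw [← map_add] at this
    exact this
  | mul x y hx hy h1 h2 =>
    have := h1.mul h2
    rw [← map_mul] at this
    exact this

lemma maximal_of_integral {A : Type*} [CommRing A] [Algebra k A] (P : Ideal A) [P.IsPrime]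
    (h : ∀ r, IsIntegral k (Ideal.Quotient.mkₐ k P r)) : P.IsMaximal := by
  have : Algebra.IsIntegral k (A ⧸ P) := by
    refine ⟨fun x => ?_⟩
    obtain ⟨r, rfl⟩ := Ideal.Quotient.mk_surjective x
    exact h r
  exact Ideal.Quotient.maximal_of_isField _ (isField_of_isIntegral_of_isField' (Field.toIsField k))

lemma integral_quot {A : Type*} [CommRing A] [Algebra k A] (P : Ideal A) (x : A)
    {f : Polynomial k} (hf : f ≠ 0) (h : Polynomial.aeval x f ∈ P) :
    IsIntegral k (Ideal.Quotient.mkₐ k P x) := by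
  refine IsAlgebraic.isIntegral ⟨f, hf, ?_⟩
  rw [Polynomial.aeval_algHom_apply]
  exact Ideal.Quotient.eq_zero_iff_mem.2 h

lemma prime_maximal (hn : 3 ≤ n)
    (hXn : X 0 ^ n ∈ veroneseMinus k n) (hYn : X 1 ^ n ∈ veroneseMinus k n)
    {f g : Polynomial k} (hf : f ≠ 0) (hg : g ≠ 0) (P : Ideal (veroneseMinus k n)) [P.IsPrime]
    (h1 : Polynomial.aeval (⟨X 0 ^ n, hXn⟩ : veroneseMinus k n) f ∈ P)
    (h2 : Polynomial.aeval (⟨X 1 ^ n, hYn⟩ : veroneseMinus k n) g ∈ P) : P.IsMaximal := by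
  refine maximal_of_integral (k := k) P fun r => ?_
  have hx := integral_quot P _ hf h1
  have hy := integral_quot P _ hg h2
  have := integral_of_hom hn hXn hYn (B := veroneseMinus k n ⧸ P) (Ideal.Quotient.mkₐ k P)
    hx hy r.1 r.2
  exact this

lemma exists_poly {A : Type*} [CommRing A] [Algebra k A] [Algebra.FiniteType k A]
    (M : Ideal A) [M.IsMaximal] (x : A) :
    ∃ f : Polynomial k, f ≠ 0 ∧ Polynomial.aeval x f ∈ M := by
  let : Field (A ⧸ M) := Ideal.Quotient.field M
  have : Module.Finite k (A ⧸ M) := finite_of_finite_type_of_isJacobsonRing _ _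
  obtain ⟨f, hf, h⟩ := (IsIntegral.of_finite k (Ideal.Quotient.mk M x)).isAlgebraic
  refine ⟨f, hf, ?_⟩
  change Polynomial.aeval (Ideal.Quotient.mkₐ k M x) f = 0 at h
  rw [Polynomial.aeval_algHom_apply] at h
  exact Ideal.Quotient.eq_zero_iff_mem.1 h

instance : IsNoetherianRing (veroneseMinus k n) := Algebra.FiniteType.isNoetherianRing k _

lemma local_data (hn : 3 ≤ n)
    (hXn : X 0 ^ n ∈ veroneseMinus k n) (hYn : X 1 ^ n ∈ veroneseMinus k n)
    (M : Ideal (veroneseMinus k n)) [M.IsMaximal] :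
    ∃ s : List (Localization.AtPrime M), s.length = 2 ∧
      (∀ a ∈ s, a ∈ IsLocalRing.maximalIdeal (Localization.AtPrime M)) ∧
      RingTheory.Sequence.IsRegular (Localization.AtPrime M) s ∧
      M.height = 2 := by
  obtain ⟨f, hf, hfM⟩ := exists_poly (k := k) M ⟨X 0 ^ n, hXn⟩
  obtain ⟨g, hg, hgM⟩ := exists_poly (k := k) M ⟨X 1 ^ n, hYn⟩
  have hw := weaklyRegular hn hXn hYn hf hg
  set p := Polynomial.aeval (⟨X 0 ^ n, hXn⟩ : veroneseMinus k n) f with hp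
  set q := Polynomial.aeval (⟨X 1 ^ n, hYn⟩ : veroneseMinus k n) g with hq
  refine local_data_aux hw hfM hgM ⟨⟨inferInstance, ?_⟩, ?_⟩
  · rw [Ideal.span_le]; rintro x (rfl | rfl) <;> assumption
  · rintro P ⟨hP, hP'⟩ hPM
    have := prime_maximal hn hXn hYn hf hg P (hP' (Ideal.subset_span (Or.inl rfl)))
      (hP' (Ideal.subset_span (Or.inr rfl)))
    exact (this.eq_of_le (Ideal.IsPrime.ne_top inferInstance) hPM).ge

/-- the strict closedness -/
lemma strictlyClosed (hn : 3 ≤ n) : IsStrictlyClosed (veroneseMinus k n) := by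
  refine strictlyClosed_aux (veroneseMinus k n).val.toRingHom Subtype.val_injective
    (AddMonoidHom.mk' (D (k := k)) D_add) (th k).toRingHom ?_ ?_ ?_
  · intro r s
    change D ((r : MvPolynomial (Fin 2) k) * s) = th k r * D s
    rw [D_mul, D_of_mem r.2, zero_mul, add_zero]
  · exact D_of_mem (n := n) (one_mem _)
  · rintro s hs ⟨a, b, hb, hab⟩
    have hb0 : (b : MvPolynomial (Fin 2) k) ≠ 0 := fun h => hb (Subtype.ext h)
    refine ⟨⟨s, mem_of_gr_D hn (gr_div (mem_gr_of_mem b.2) hb0 ?_) hs⟩, rfl⟩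
    have hab' : (b : MvPolynomial (Fin 2) k) * s = a := hab
    rw [hab']
    exact mem_gr_of_mem a.2

end VM

set_option synthInstance.maxHeartbeats 1000000 in
set_option maxHeartbeats 1000000 in
/-- Let `S = k[X, Y]`, `n ≥ 3` and
`R = k[Xⁿ⁻ⁱYⁱ : 0 ≤ i ≤ n, i ≠ 1] ⊆ S`.  Then `R` is strictly closed, `Xⁿ, Yⁿ` is a regular
sequence on `R`, and `R` is a Cohen–Macaulay ring of Krull dimension `2`. -/
theorem veroneseMinus_strictlyClosed_CohenMacaulay
    (k : Type*) [Field k] (n : ℕ) (hn : 3 ≤ n)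
    (hXn : X 0 ^ n ∈ veroneseMinus k n) (hYn : X 1 ^ n ∈ veroneseMinus k n) :
    IsStrictlyClosed (veroneseMinus k n) ∧
    RingTheory.Sequence.IsRegular (veroneseMinus k n)
      [(⟨X 0 ^ n, hXn⟩ : veroneseMinus k n), (⟨X 1 ^ n, hYn⟩ : veroneseMinus k n)] ∧
    IsCohenMacaulayRing (veroneseMinus k n) ∧
    ringKrullDim (veroneseMinus k n) = 2 := by
  refine ⟨VM.strictlyClosed hn, VM.regularXY hn hXn hYn, ?_, ?_⟩
  · intro M hM
    obtain ⟨s, h1, h2, h3, h4⟩ := VM.local_data hn hXn hYn M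
    refine ⟨s, h2, h3, ?_⟩
    rw [IsLocalization.AtPrime.ringKrullDim_eq_height M (Localization.AtPrime M), h1, h4]
    rfl
  · apply le_antisymm
    · rw [ringKrullDim_le_iff_isMaximal_height_le]
      intro M hM
      obtain ⟨s, h1, h2, h3, h4⟩ := VM.local_data hn hXn hYn M
      rw [h4]
      rfl
    · obtain ⟨M, hM⟩ := Ideal.exists_maximal (veroneseMinus k n)
      obtain ⟨s, h1, h2, h3, h4⟩ := VM.local_data hn hXn hYn M
      have := Ideal.height_le_ringKrullDim_of_ne_top hM.ne_top
      rw [h4] at this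
      exact this
end

section
/- Let S be a regular local ring and let a₁, a₂, ..., a_m, b₁, b₂, ..., b_n be a regular system of parameters of S (so m + n = dim S, and these elements generate the maximal ideal of S). Then the quotient ring R = S/[(a₁, ..., a_m) ∩ (b₁, ..., b_n)] is strictly closed, and hence R is a weakly Arf ring. -/
open scoped TensorProduct

namespace SCAux

/-- Elementary complete integral closedness. -/
def CIC (A : Type*) [CommRing A] : Prop :=
  ∀ y z c : A, c ≠ 0 → z ≠ 0 → (∀ n : ℕ, z ^ n ∣ c * y ^ n) → z ∣ y

lemma CIC.isIntegrallyClosed {A : Type*} [CommRing A] [IsDomain A] (h : CIC A) :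
    IsIntegrallyClosed A := by
  rw [isIntegrallyClosed_iff (FractionRing A)]
  intro s hs
  obtain ⟨c, hc, hcn⟩ := hs.isAlmostIntegral
  obtain ⟨y, z, hz, rfl⟩ := IsFractionRing.div_surjective (A := A) s
  have hz0 : z ≠ 0 := nonZeroDivisors.ne_zero hz
  have hinj := IsFractionRing.injective A (FractionRing A)
  have hz1 : algebraMap A (FractionRing A) z ≠ 0 := by
    simpa using hz0
  obtain ⟨e, rfl⟩ := h y z c (nonZeroDivisors.ne_zero hc) hz0 (by
    intro n
    obtain ⟨w, hw⟩ := hcn n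
    refine ⟨w, hinj ?_⟩
    rw [Algebra.smul_def, div_pow] at hw
    simp only [map_mul, map_pow, hw]
    field_simp)
  refine ⟨e, ?_⟩
  rw [map_mul]
  field_simp

lemma CIC.step {S : Type*} [CommRing S] [IsDomain S] [IsNoetherianRing S]
    {x : S} (hx : Prime x) (h : CIC (S ⧸ Ideal.span {x})) {z c : S} (hc : c ≠ 0) (hz : z ≠ 0)
    (N : ℕ) (y : S) (hy : x ^ N ∣ y) (hn : ∀ n : ℕ, z ^ n ∣ c * y ^ n) :
    ∃ e, x ^ (N + 1) ∣ y - z * e := by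
  obtain ⟨y0, rfl⟩ := hy
  by_cases hxy : x ∣ y0
  · refine ⟨0, ?_⟩
    rw [mul_zero, sub_zero, pow_succ]
    exact mul_dvd_mul_left _ hxy
  obtain ⟨z0, hz0, hxz⟩ :=
    (FiniteMultiplicity.of_not_isUnit hx.not_isUnit hz).exists_eq_pow_mul_and_not_dvd
  obtain ⟨c0, hc0, hxc⟩ :=
    (FiniteMultiplicity.of_not_isUnit hx.not_isUnit hc).exists_eq_pow_mul_and_not_dvd
  generalize multiplicity x z = q at hz0
  generalize multiplicity x c = r at hc0
  subst hz0 hc0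
  have hcy : ∀ n, ¬ x ∣ c0 * y0 ^ n := fun n hd => by
    rcases hx.dvd_or_dvd hd with hd | hd
    · exact hxc hd
    · exact hxy (hx.dvd_of_dvd_pow hd)
  have hqN : q ≤ N := by
    have h1 := hn (r + 1)
    have h2 : x ^ (q * (r + 1)) ∣ x ^ (r + N * (r + 1)) * (c0 * y0 ^ (r + 1)) := by
      refine dvd_trans ⟨z0 ^ (r + 1), ?_⟩ (h1.trans (dvd_of_eq ?_))
      · ring
      · ring
    have h3 := hx.pow_dvd_of_dvd_mul_right _ (hcy _) h2
    rw [pow_dvd_pow_iff hx.ne_zero hx.not_isUnit] at h3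
    by_contra hlt
    push Not at hlt
    nlinarith
  obtain ⟨k, rfl⟩ := Nat.exists_eq_add_of_le hqN
  have hx0 := hx.ne_zero
  have key : ∀ n, z0 ^ n ∣ c0 * y0 ^ n := by
    intro n
    obtain ⟨w, hw⟩ := hn n
    have h1 : x ^ (r + k * n) * (c0 * y0 ^ n) = w * z0 ^ n := by
      apply mul_left_cancel₀ (pow_ne_zero (q * n) hx0)
      linear_combination hw
    have h2 : x ^ (r + k * n) ∣ w :=
      hx.pow_dvd_of_dvd_mul_right _ (fun hd => hxz (hx.dvd_of_dvd_pow hd)) ⟨_, h1.symm⟩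
    obtain ⟨w', rfl⟩ := h2
    refine ⟨w', mul_left_cancel₀ (pow_ne_zero (r + k * n) hx0) ?_⟩
    linear_combination h1
  have hmk : ∀ a : S, Ideal.Quotient.mk (Ideal.span {x}) a = 0 ↔ x ∣ a := fun a => by
    rw [Ideal.Quotient.eq_zero_iff_mem, Ideal.mem_span_singleton]
  obtain ⟨e, he⟩ := h (Ideal.Quotient.mk _ y0) (Ideal.Quotient.mk _ z0) (Ideal.Quotient.mk _ c0)
    (fun h0 => hxc ((hmk _).1 h0)) (fun h0 => hxz ((hmk _).1 h0)) (fun n => by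
      simpa using map_dvd (Ideal.Quotient.mk (Ideal.span {x})) (key n))
  obtain ⟨e, rfl⟩ := Ideal.Quotient.mk_surjective e
  rw [← map_mul, ← sub_eq_zero, ← map_sub, hmk] at he
  obtain ⟨t, ht⟩ := he
  refine ⟨x ^ k * e, t, ?_⟩
  linear_combination x ^ (q + k) * ht

lemma CIC.of_quotient {S : Type*} [CommRing S] [IsDomain S] [IsNoetherianRing S] [IsLocalRing S]
    {x : S} (hx : Prime x) (h : CIC (S ⧸ Ideal.span {x})) : CIC S := by
  intro y z c hc hz hn
  have main : ∀ N : ℕ, ∃ e, x ^ N ∣ y - z * e := by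
    intro N
    induction N with
    | zero => exact ⟨0, by simp⟩
    | succ N ih =>
      obtain ⟨e, he⟩ := ih
      obtain ⟨e', he'⟩ := CIC.step hx h hc hz N (y - z * e) he (by
        intro n
        rw [sub_eq_add_neg, add_pow, Finset.mul_sum]
        refine Finset.dvd_sum fun i hi => ?_
        have hi' : i ≤ n := by simpa [Nat.lt_succ_iff] using hi
        have : c * (y ^ i * (-(z * e)) ^ (n - i) * (n.choose i : S))
            = (c * y ^ i) * z ^ (n - i) * ((-e) ^ (n - i) * (n.choose i : S)) := by
          rw [show -(z * e) = z * (-e) by ring, mul_pow]; ring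
        rw [this]
        apply Dvd.dvd.mul_right
        conv_lhs => rw [← Nat.add_sub_cancel' hi', pow_add]
        exact mul_dvd_mul_right (hn i) _)
      exact ⟨e + e', by convert he' using 1; ring⟩
  have hxt : Ideal.span {x} ≠ ⊤ := by
    rw [Ne, Ideal.span_singleton_eq_top]; exact hx.not_isUnit
  have hk := Ideal.iInf_pow_smul_eq_bot_of_isLocalRing (M := S ⧸ Ideal.span {z})
    (Ideal.span {x}) hxt
  have : (Ideal.Quotient.mk (Ideal.span {z}) y) ∈ (⊥ : Submodule S (S ⧸ Ideal.span {z})) := by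
    rw [← hk, Submodule.mem_iInf]
    intro N
    obtain ⟨e, t, ht⟩ := main N
    have : Ideal.Quotient.mk (Ideal.span {z}) y = x ^ N • Ideal.Quotient.mk (Ideal.span {z}) t := by
      rw [Algebra.smul_def, Ideal.Quotient.algebraMap_eq, ← map_mul, Ideal.Quotient.eq, ← ht,
        Ideal.mem_span_singleton]
      exact ⟨e, by ring⟩
    rw [this]
    refine Submodule.smul_mem_smul ?_ trivial
    exact Ideal.pow_mem_pow (Ideal.mem_span_singleton_self x) N
  rw [Submodule.mem_bot, Ideal.Quotient.eq_zero_iff_mem, Ideal.mem_span_singleton] at this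
  exact this

lemma cancel_aux {d n : ℕ} {a : WithBot ℕ∞} (h : ((d + n : ℕ) : WithBot ℕ∞) ≤ a + (n : ℕ)) :
    (d : WithBot ℕ∞) ≤ a := by
  induction a with
  | bot => simp at h
  | coe a =>
    induction a with
    | top => exact_mod_cast le_top
    | coe a => 
      norm_cast at h ⊢
      omega

lemma dim_le {S : Type*} [CommRing S] [IsNoetherianRing S] [IsLocalRing S] {d : ℕ} {s : Set S}
    (hs : s.encard ≤ d) (hgen : Ideal.span s = IsLocalRing.maximalIdeal S) :
    ringKrullDim S ≤ d := by
  refine (ringKrullDim_le_spanFinrank_maximalIdeal S).trans ?_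
  rw [← hgen]
  have := (Submodule.spanFinrank_span_le_encard (R := S) s).trans hs
  exact_mod_cast this

lemma exists_prime {S : Type*} [CommRing S] {d : ℕ} (h : (d : WithBot ℕ∞) ≤ ringKrullDim S) :
    ∃ Q : Ideal S, Q.IsPrime ∧ (d : WithBot ℕ∞) ≤ ringKrullDim (S ⧸ Q) := by
  obtain ⟨l, hl⟩ := Order.le_krullDim_iff.1 h
  refine ⟨l.head.asIdeal, l.head.isPrime, ?_⟩
  rw [ringKrullDim_quotient, Order.le_krullDim_iff]
  refine ⟨⟨l.length, fun i => ⟨l i, ?_⟩, fun i => l.step i⟩, hl⟩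
  exact (LTSeries.head_le l i : l.head ≤ l i)

theorem regular {d : ℕ} : ∀ {S : Type*} [CommRing S] [IsNoetherianRing S] [IsLocalRing S]
    {s : Set S}, s.encard ≤ d → Ideal.span s = IsLocalRing.maximalIdeal S →
    (d : WithBot ℕ∞) ≤ ringKrullDim S → IsDomain S ∧ CIC S := by
  induction d with
  | zero =>
    intro S _ _ _ s hs hgen hdim
    have : s = ∅ := by simpa using hs
    subst this
    have hF : IsField S := by
      rw [IsLocalRing.isField_iff_maximalIdeal_eq, ← hgen, Ideal.span_empty]
    refine ⟨hF.isDomain, fun y z c _ hz _ => ?_⟩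
    obtain ⟨w, hw⟩ := hF.mul_inv_cancel hz
    exact ⟨w * y, by rw [← mul_assoc, hw, one_mul]⟩
  | succ d ih =>
    intro S _ _ _ s hs hgen hdim
    rcases s.eq_empty_or_nonempty with rfl | ⟨x, hxs⟩
    · exfalso
      have hd := hdim.trans (dim_le (d := 0) (by simp) hgen)
      norm_cast at hd
    have hxm : x ∈ IsLocalRing.maximalIdeal S := hgen ▸ Ideal.subset_span hxs
    have hxu : ¬ IsUnit x := hxm
    let f := Ideal.Quotient.mk (Ideal.span {x})
    have hf : Function.Surjective f := Ideal.Quotient.mk_surjective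
    have hnt : Nontrivial (S ⧸ Ideal.span {x}) := by
      rw [Ideal.Quotient.nontrivial_iff, Ne, Ideal.span_singleton_eq_top]; exact hxu
    have hloc : IsLocalRing (S ⧸ Ideal.span {x}) := IsLocalRing.of_surjective' f hf
    have hcard : (f '' (s \ {x})).encard ≤ d := by
      refine (Set.encard_image_le _ _).trans ?_
      have := Set.encard_sdiff_singleton_add_one hxs
      rw [← this] at hs
      push_cast at hs
      exact (ENat.add_le_add_iff_right (by simp)).1 hs
    have hgen' : Ideal.span (f '' (s \ {x})) = IsLocalRing.maximalIdeal _ := by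
      rw [← IsLocalRing.map_maximalIdeal_of_surjective f hf, ← hgen, Ideal.map_span]
      apply le_antisymm (Ideal.span_mono (Set.image_mono Set.sdiff_subset))
      rw [Ideal.span_le]
      rintro _ ⟨w, hw, rfl⟩
      by_cases hwx : w = x
      · subst hwx
        have : f w = 0 := Ideal.Quotient.eq_zero_iff_mem.2 (Ideal.mem_span_singleton_self _)
        rw [this]; exact zero_mem _
      · exact Ideal.subset_span ⟨w, ⟨hw, hwx⟩, rfl⟩
    have hdim' : (d : WithBot ℕ∞) ≤ ringKrullDim (S ⧸ Ideal.span {x}) := by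
      apply cancel_aux (n := 1)
      refine hdim.trans ((ringKrullDim_le_ringKrullDim_quotient_add_encard {x} ?_).trans ?_)
      · rw [IsLocalRing.ringJacobson_eq_maximalIdeal]; simpa using hxm
      · simp
    obtain ⟨hdom, hcic⟩ := ih hcard hgen' hdim'
    have hle := dim_le hcard hgen'
    obtain ⟨Q, hQ, hQd⟩ := exists_prime hdim
    have hxQ : x ∉ Q := by
      intro hxQ
      have h1 : ringKrullDim (S ⧸ Q) ≤ ringKrullDim (S ⧸ Ideal.span {x}) :=
        ringKrullDim_le_of_surjective
          (Ideal.Quotient.factor ((Ideal.span_singleton_le_iff_mem _).2 hxQ))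
          (Ideal.Quotient.factor_surjective _)
      have h2 := (hQd.trans h1).trans hle
      norm_cast at h2
      omega
    let g := Ideal.Quotient.mk Q
    have hg : Function.Surjective g := Ideal.Quotient.mk_surjective
    have hlocQ : IsLocalRing (S ⧸ Q) := IsLocalRing.of_surjective' g hg
    have hTd : (d : WithBot ℕ∞) ≤ ringKrullDim ((S ⧸ Q) ⧸ Ideal.span {g x}) := by
      apply cancel_aux (n := 1)
      refine hQd.trans ((ringKrullDim_le_ringKrullDim_quotient_add_encard {g x} ?_).trans ?_)
      · rw [IsLocalRing.ringJacobson_eq_maximalIdeal,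
          ← IsLocalRing.map_maximalIdeal_of_surjective g hg]
        simpa using Ideal.mem_map_of_mem g hxm
      · simp
    have hQx : Q ≤ Ideal.span {x} := by
      intro q hq
      by_contra hqx
      have hq0 : f q ≠ 0 := fun h0 => hqx (Ideal.Quotient.eq_zero_iff_mem.1 h0)
      have h1 := ringKrullDim_quotient_succ_le_of_nonZeroDivisor
        (mem_nonZeroDivisors_of_ne_zero hq0)
      let φ : S →+* ((S ⧸ Q) ⧸ Ideal.span {g x}) := (Ideal.Quotient.mk _).comp g
      have hφ : Function.Surjective φ := Ideal.Quotient.mk_surjective.comp hg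
      let φ1 : (S ⧸ Ideal.span {x}) →+* ((S ⧸ Q) ⧸ Ideal.span {g x}) :=
        Ideal.Quotient.lift _ φ (fun a ha => by
          obtain ⟨t, rfl⟩ := Ideal.mem_span_singleton.1 ha
          refine Ideal.Quotient.eq_zero_iff_mem.2 (Ideal.mem_span_singleton.2 ?_)
          exact ⟨g t, map_mul _ _ _⟩)
      let φ2 : ((S ⧸ Ideal.span {x}) ⧸ Ideal.span {f q}) →+* ((S ⧸ Q) ⧸ Ideal.span {g x}) :=
        Ideal.Quotient.lift _ φ1 (fun a ha => by
          obtain ⟨t, rfl⟩ := Ideal.mem_span_singleton.1 ha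
          have h0 : φ1 (f q) = 0 := by
            change Ideal.Quotient.mk _ (g q) = 0
            rw [show g q = 0 from Ideal.Quotient.eq_zero_iff_mem.2 hq, map_zero]
          rw [map_mul, h0, zero_mul])
      have hφ2 : Function.Surjective φ2 := fun a => by
        obtain ⟨b, rfl⟩ := hφ a
        exact ⟨Ideal.Quotient.mk _ (f b), rfl⟩
      have h2 := ringKrullDim_le_of_surjective φ2 hφ2
      have h3 : ((d + 1 : ℕ) : WithBot ℕ∞) ≤ d := by
        refine le_trans ?_ (h1.trans hle)
        push_cast
        gcongr
        exact hTd.trans h2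
      norm_cast at h3
      omega
    have hQ0 : Q = ⊥ := by
      refine Submodule.eq_bot_of_le_smul_of_le_jacobson_bot (IsLocalRing.maximalIdeal S) Q
        (IsNoetherian.noetherian Q) ?_ ?_
      · intro q hq
        obtain ⟨t, rfl⟩ := Ideal.mem_span_singleton.1 (hQx hq)
        exact Submodule.smul_mem_smul hxm ((hQ.mem_or_mem hq).resolve_left hxQ)
      · exact IsLocalRing.maximalIdeal_le_jacobson _
    subst hQ0
    have hD : IsDomain S := 
      (MulEquiv.isDomain_iff (RingEquiv.quotientBot S).toMulEquiv).1
        ((Ideal.Quotient.isDomain_iff_prime _).2 hQ)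
    refine ⟨hD, CIC.of_quotient (x := x) ?_ hcic⟩
    rw [← Ideal.span_singleton_prime (by simpa using hxQ)]
    exact (Ideal.Quotient.isDomain_iff_prime _).1 hdom

lemma weaklyArf {R : Type*} [CommRing R] (h : IsStrictlyClosed R) : IsWeaklyArf R := by
  rintro x y z hx ⟨u, hu, hux⟩ ⟨v, hv, hvx⟩
  let U : integralClosure R (FractionRing R) := ⟨u, hu⟩
  let V : integralClosure R (FractionRing R) := ⟨v, hv⟩
  have hU : x • U = algebraMap R _ y := by
    apply Subtype.ext
    change x • u = algebraMap R _ y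
    rw [Algebra.smul_def, mul_comm, hux]
  have hV : x • V = algebraMap R _ z := by
    apply Subtype.ext
    change x • v = algebraMap R _ z
    rw [Algebra.smul_def, mul_comm, hvx]
  obtain ⟨r, hr⟩ := h (x • (U * V)) (by
    have e1 : x • (U * V) = y • V := by
      rw [← smul_mul_assoc, hU, Algebra.smul_def]
    have e2 : x • (U * V) = z • U := by
      rw [← mul_smul_comm, hV, Algebra.smul_def, mul_comm]
    calc (x • (U * V)) ⊗ₜ[R] (1 : integralClosure R (FractionRing R))
        = V ⊗ₜ[R] (x • U) := by
          rw [e1, TensorProduct.smul_tmul, hU, Algebra.algebraMap_eq_smul_one]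
      _ = (x • V) ⊗ₜ[R] U := by rw [TensorProduct.smul_tmul]
      _ = 1 ⊗ₜ[R] (x • (U * V)) := by
          rw [e2, hV, Algebra.algebraMap_eq_smul_one, TensorProduct.smul_tmul])
  refine ⟨r, ?_⟩
  have hr' : algebraMap R (FractionRing R) r = x • (u * v) := congrArg Subtype.val hr
  rw [hr', map_mul, ← hux, ← hvx, Algebra.smul_def]
  ring

lemma strictlyClosed_of_normal {R : Type*} [CommRing R] [IsIntegrallyClosed R] :
    IsStrictlyClosed R := by
  rintro ⟨s, hs⟩ -
  obtain ⟨r, hr⟩ := (isIntegrallyClosed_iff (FractionRing R)).1 inferInstance hs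
  exact ⟨r, Subtype.ext hr⟩

/-- The projection from the integral closure to a normal quotient. -/
lemma exists_proj {R A : Type*} [CommRing R] [CommRing A] [IsDomain A] [IsIntegrallyClosed A]
    [Algebra R A] (h : ∀ x ∈ nonZeroDivisors R, algebraMap R A x ≠ 0) :
    Nonempty (integralClosure R (FractionRing R) →ₐ[R] A) := by
  let K := FractionRing A
  let ψ : FractionRing R →ₐ[R] K := IsLocalization.liftAlgHom (M := nonZeroDivisors R)
    (f := Algebra.ofId R K) (fun x => by
      rw [isUnit_iff_ne_zero]
      change algebraMap R K x ≠ 0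
      rw [IsScalarTower.algebraMap_apply R A K]
      simpa using h x x.2)
  have hψ : ∀ s : integralClosure R (FractionRing R), ψ s ∈ (IsScalarTower.toAlgHom R A K).range := by
    rintro ⟨s, hs⟩
    have h1 : IsIntegral R (ψ s) := IsIntegral.map ψ hs
    obtain ⟨r, hr⟩ := (isIntegrallyClosed_iff K).1 inferInstance (h1.tower_top (A := A))
    exact ⟨r, hr⟩
  let e : A ≃ₐ[R] (IsScalarTower.toAlgHom R A K).range :=
    AlgEquiv.ofInjective _ (IsFractionRing.injective A K)
  exact ⟨e.symm.toAlgHom.comp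
    ((ψ.comp (integralClosure R (FractionRing R)).val).codRestrict _ hψ)⟩

lemma eq_of_tmul {R B T : Type*} [CommRing R] [CommRing B] [CommRing T] [Algebra R B] [Algebra R T]
    (f g : B →ₐ[R] T) {s : B} (hs : s ⊗ₜ[R] (1 : B) = (1 : B) ⊗ₜ[R] s) : f s = g s := by
  simpa using congrArg (Algebra.TensorProduct.productMap f g) hs

lemma strictlyClosed_inf {S : Type*} [CommRing S] (I J : Ideal S)
    (hI : IsDomain (S ⧸ I)) (hI' : IsIntegrallyClosed (S ⧸ I))
    (hJ : IsDomain (S ⧸ J)) (hJ' : IsIntegrallyClosed (S ⧸ J))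
    (hIJ : ¬ I ≤ J) (hJI : ¬ J ≤ I) :
    IsStrictlyClosed (S ⧸ (I ⊓ J)) := by
  let R := S ⧸ (I ⊓ J)
  let _ : Algebra R (S ⧸ I) := (Ideal.Quotient.factor (inf_le_left : I ⊓ J ≤ I)).toAlgebra
  let _ : Algebra R (S ⧸ J) := (Ideal.Quotient.factor (inf_le_right : I ⊓ J ≤ J)).toAlgebra
  let _ : Algebra R (S ⧸ (I ⊔ J)) :=
    (Ideal.Quotient.factor (inf_le_left.trans le_sup_left : I ⊓ J ≤ I ⊔ J)).toAlgebra
  have hnz : ∀ (P P' : Ideal S), P ⊓ P' = I ⊓ J → ¬ P' ≤ P → ∀ x : S,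
      Ideal.Quotient.mk (I ⊓ J) x ∈ nonZeroDivisors R → x ∉ P := by
    intro P P' hPP hle x hx hxP
    apply hle
    intro p hp
    have : Ideal.Quotient.mk (I ⊓ J) p = 0 := by
      refine (mem_nonZeroDivisors_iff.1 hx).2 _ ?_
      rw [← map_mul, Ideal.Quotient.eq_zero_iff_mem, ← hPP]
      exact ⟨P.mul_mem_left _ hxP, P'.mul_mem_right _ hp⟩
    rw [Ideal.Quotient.eq_zero_iff_mem, ← hPP] at this
    exact this.1
  obtain ⟨α⟩ := exists_proj (R := R) (A := S ⧸ I) (by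
    intro x hx h0
    obtain ⟨x, rfl⟩ := Ideal.Quotient.mk_surjective x
    exact hnz I J rfl hJI x hx (Ideal.Quotient.eq_zero_iff_mem.1 h0))
  obtain ⟨β⟩ := exists_proj (R := R) (A := S ⧸ J) (by
    intro x hx h0
    obtain ⟨x, rfl⟩ := Ideal.Quotient.mk_surjective x
    exact hnz J I (inf_comm _ _) hIJ x hx (Ideal.Quotient.eq_zero_iff_mem.1 h0))
  let πI : (S ⧸ I) →ₐ[R] (S ⧸ (I ⊔ J)) :=
    { Ideal.Quotient.factor (le_sup_left : I ≤ I ⊔ J) with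
      commutes' := fun r => by
        obtain ⟨r, rfl⟩ := Ideal.Quotient.mk_surjective r
        rfl }
  let πJ : (S ⧸ J) →ₐ[R] (S ⧸ (I ⊔ J)) :=
    { Ideal.Quotient.factor (le_sup_right : J ≤ I ⊔ J) with
      commutes' := fun r => by
        obtain ⟨r, rfl⟩ := Ideal.Quotient.mk_surjective r
        rfl }
  intro s hs
  have h1 := eq_of_tmul (πI.comp α) (πJ.comp β) hs
  obtain ⟨F, hF⟩ := Ideal.Quotient.mk_surjective (α s)
  obtain ⟨G, hG⟩ := Ideal.Quotient.mk_surjective (β s)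
  have h2 : Ideal.Quotient.mk (I ⊔ J) F = Ideal.Quotient.mk (I ⊔ J) G := by
    have h1' : πI (α s) = πJ (β s) := h1
    rw [← hF, ← hG] at h1'
    exact h1'
  rw [Ideal.Quotient.eq, Submodule.mem_sup] at h2
  obtain ⟨i, hi, j, hj, hij⟩ := h2
  let r : R := Ideal.Quotient.mk _ (F - i)
  have hα : α (s - algebraMap R _ r) = 0 := by
    rw [map_sub, AlgHom.commutes, ← hF, sub_eq_zero]
    change _ = Ideal.Quotient.mk I (F - i)
    rw [Ideal.Quotient.eq]
    simpa using hi
  have hβ : β (s - algebraMap R _ r) = 0 := by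
    rw [map_sub, AlgHom.commutes, ← hG, sub_eq_zero]
    change _ = Ideal.Quotient.mk J (F - i)
    rw [Ideal.Quotient.eq, show G - (F - i) = -j by linear_combination hij]
    exact J.neg_mem hj
  refine ⟨r, ?_⟩
  rw [eq_comm, ← sub_eq_zero]
  generalize s - algebraMap R _ r = w at hα hβ
  obtain ⟨⟨y, x⟩, hxy⟩ := IsLocalization.surj (nonZeroDivisors R) (w : FractionRing R)
  have hw : w * algebraMap R _ (x : R) = algebraMap R _ y := Subtype.ext hxy
  have hyα : algebraMap R (S ⧸ I) y = 0 := by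
    rw [← α.commutes, ← hw, map_mul, hα, zero_mul]
  have hyβ : algebraMap R (S ⧸ J) y = 0 := by
    rw [← β.commutes, ← hw, map_mul, hβ, zero_mul]
  have hy : y = 0 := by
    obtain ⟨y, rfl⟩ := Ideal.Quotient.mk_surjective y
    exact Ideal.Quotient.eq_zero_iff_mem.2
      ⟨Ideal.Quotient.eq_zero_iff_mem.1 hyα, Ideal.Quotient.eq_zero_iff_mem.1 hyβ⟩
  apply Subtype.ext
  have hu := IsLocalization.map_units (FractionRing R) x
  apply hu.mul_left_injective
  simpa [hy] using hxy

lemma quotient_regular {S : Type*} [CommRing S] [IsNoetherianRing S] [IsLocalRing S]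
    {m n : ℕ} {s t : Set S} (hs : s.encard ≤ m) (ht : t.encard ≤ n)
    (hgen : Ideal.span (s ∪ t) = IsLocalRing.maximalIdeal S)
    (hdim : ringKrullDim S = ((n + m : ℕ) : WithBot ℕ∞)) :
    IsDomain (S ⧸ Ideal.span s) ∧ IsIntegrallyClosed (S ⧸ Ideal.span s) := by
  have hsm : s ⊆ IsLocalRing.maximalIdeal S := fun x hx =>
    hgen ▸ Ideal.subset_span (Or.inl hx)
  have hne : Ideal.span s ≠ ⊤ := fun h =>
    (IsLocalRing.maximalIdeal.isMaximal S).ne_top (top_le_iff.1 (h ▸ Ideal.span_le.2 hsm))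
  have hnt : Nontrivial (S ⧸ Ideal.span s) := Ideal.Quotient.nontrivial_iff.2 hne
  let f := Ideal.Quotient.mk (Ideal.span s)
  have hf : Function.Surjective f := Ideal.Quotient.mk_surjective
  have hloc : IsLocalRing (S ⧸ Ideal.span s) := IsLocalRing.of_surjective' f hf
  have key := regular (S := S ⧸ Ideal.span s) (s := f '' t) (d := n)
    ((Set.encard_image_le _ _).trans ht) (by
      rw [← IsLocalRing.map_maximalIdeal_of_surjective f hf, ← hgen, Ideal.span_union,
        Ideal.map_sup, Ideal.map_quotient_self, bot_sup_eq, Ideal.map_span]) (by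
      apply cancel_aux (n := m)
      rw [← hdim]
      refine (ringKrullDim_le_ringKrullDim_quotient_add_encard s ?_).trans ?_
      · rw [IsLocalRing.ringJacobson_eq_maximalIdeal]; exact hsm
      · gcongr
        exact_mod_cast hs)
  have := key.1
  exact ⟨key.1, key.2.isIntegrallyClosed⟩

end SCAux

/-- Let `S` be a regular local ring and `a₁, …, a_m, b₁, …, b_n` a regular
system of parameters of `S` (encoded: `S` is Noetherian local, the `aᵢ` and `bⱼ` together
generate the maximal ideal, and `m + n = dim S`; such an `S` is exactly a regular local ring
with regular system of parameters `a₁, …, a_m, b₁, …, b_n`).  Then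
`R = S/[(a₁, …, a_m) ∩ (b₁, …, b_n)]` is strictly closed, and hence weakly Arf. -/
theorem quotient_by_intersection_of_parameter_ideals_strictlyClosed
    (S : Type*) [CommRing S] [IsNoetherianRing S] [IsLocalRing S]
    (m n : ℕ) (a : Fin m → S) (b : Fin n → S)
    (hgen : Ideal.span (Set.range a ∪ Set.range b) = IsLocalRing.maximalIdeal S)
    (hdim : ringKrullDim S = ((m + n : ℕ) : WithBot ℕ∞)) :
    IsStrictlyClosed (S ⧸ (Ideal.span (Set.range a) ⊓ Ideal.span (Set.range b))) ∧
    IsWeaklyArf (S ⧸ (Ideal.span (Set.range a) ⊓ Ideal.span (Set.range b))) := by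
  suffices h : IsStrictlyClosed (S ⧸ (Ideal.span (Set.range a) ⊓ Ideal.span (Set.range b))) from
    ⟨h, SCAux.weaklyArf h⟩
  have ha : (Set.range a).encard ≤ m := by
    rw [← Set.image_univ]
    exact (Set.encard_image_le _ _).trans (by simp)
  have hb : (Set.range b).encard ≤ n := by
    rw [← Set.image_univ]
    exact (Set.encard_image_le _ _).trans (by simp)
  obtain ⟨hI, hI'⟩ := SCAux.quotient_regular ha hb hgen (by rw [hdim, add_comm])
  obtain ⟨hJ, hJ'⟩ := SCAux.quotient_regular hb ha (by rw [Set.union_comm, hgen]) hdim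
  by_cases hIJ : Ideal.span (Set.range a) ≤ Ideal.span (Set.range b)
  · rw [inf_eq_left.2 hIJ]
    exact SCAux.strictlyClosed_of_normal
  by_cases hJI : Ideal.span (Set.range b) ≤ Ideal.span (Set.range a)
  · rw [inf_eq_right.2 hJI]
    exact SCAux.strictlyClosed_of_normal
  exact SCAux.strictlyClosed_inf _ _ hI hI' hJ hJ' hIJ hJI
end

section
/- Let S = k[[X₁, X₂, ..., X_d]] (d > 0) be the formal power series ring over a field k with maximal ideal 𝔫 = (X₁, ..., X_d), let J be any 𝔫-primary ideal of S, and set R = k + J ⊆ S. Then R is a Noetherian local ring with maximal ideal J, the integral closure of R in Q(R) is S, and R is a weakly Arf ring. -/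
/-- complete integral closedness, in elementary form -/
def CIC (A : Type*) [CommRing A] : Prop :=
  ∀ f g h : A, g ≠ 0 → h ≠ 0 → (∀ n : ℕ, g ^ n ∣ h * f ^ n) → g ∣ f

theorem CIC.of_field (k : Type*) [Field k] : CIC k := by
  intro f g h hg _ _
  exact (IsUnit.mk0 g hg).dvd

theorem CIC.of_equiv {A B : Type*} [CommRing A] [CommRing B] (e : A ≃+* B) (h : CIC A) : CIC B := by
  intro f g u hg hu H
  have := h (e.symm f) (e.symm g) (e.symm u) (by simpa using hg) (by simpa using hu) (fun n => by
    have := map_dvd e.symm (H n)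
    simpa using this)
  simpa using map_dvd e this

theorem CIC.aux {A : Type*} [CommRing A] [IsDomain A] (hA : CIC A) (f g h : PowerSeries A)
    (hg : PowerSeries.constantCoeff g ≠ 0) (hh : PowerSeries.constantCoeff h ≠ 0)
    (H : ∀ n : ℕ, g ^ n ∣ h * f ^ n) : g ∣ f := by
  have hX : ¬ (PowerSeries.X ∣ g) := by rwa [PowerSeries.X_dvd_iff]
  have step : ∀ f : {f : PowerSeries A // ∀ n : ℕ, g ^ n ∣ h * f ^ n},
      ∃ (q : A) (f' : {f : PowerSeries A // ∀ n : ℕ, g ^ n ∣ h * f ^ n}),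
        f.1 = PowerSeries.C q * g + PowerSeries.X * f'.1 := by
    rintro ⟨f, hf⟩
    obtain ⟨q, hq⟩ := hA (PowerSeries.constantCoeff f) _ _ hg hh (fun n => by
      simpa using map_dvd PowerSeries.constantCoeff (hf n))
    have : PowerSeries.X ∣ f - PowerSeries.C q * g := by
      rw [PowerSeries.X_dvd_iff]; simp [hq]; ring
    obtain ⟨f', hf'⟩ := this
    refine ⟨q, ⟨f', fun n => ?_⟩, by rw [← hf']; ring⟩
    have h1 : g ^ n ∣ h * (f - PowerSeries.C q * g) ^ n := by
      rw [sub_eq_add_neg, add_pow, Finset.mul_sum]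
      refine Finset.dvd_sum fun i hi => ?_
      have hi' : i ≤ n := by simpa [Nat.lt_succ_iff] using hi
      obtain ⟨c, hc⟩ := hf i
      refine ⟨c * (-PowerSeries.C q) ^ (n - i) * (n.choose i), ?_⟩
      have : g ^ n = g ^ i * g ^ (n - i) := by rw [← pow_add]; congr 1; omega
      rw [this, show -(PowerSeries.C q * g) = (-PowerSeries.C q) * g by ring, mul_pow]
      linear_combination ((-PowerSeries.C q) ^ (n-i) * g ^ (n-i) * (n.choose i)) * hc
    rw [hf', mul_pow, mul_left_comm] at h1
    obtain ⟨c, hc⟩ := h1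
    have h2 : PowerSeries.X ^ n ∣ g ^ n * c := ⟨_, hc.symm⟩
    have h3 := (PowerSeries.X_prime (R := A)).pow_dvd_of_dvd_mul_left n
      (fun h => hX ((PowerSeries.X_prime (R := A)).dvd_of_dvd_pow h)) h2
    obtain ⟨e, rfl⟩ := h3
    refine ⟨e, ?_⟩
    have hne : (PowerSeries.X : PowerSeries A) ^ n ≠ 0 := pow_ne_zero _ PowerSeries.X_ne_zero
    apply mul_left_cancel₀ hne
    rw [hc]; ring
  choose Q F hF using step
  let s : ℕ → {f : PowerSeries A // ∀ n : ℕ, g ^ n ∣ h * f ^ n} := fun n => F^[n] ⟨f, H⟩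
  have hs : ∀ n, (s n).1 = PowerSeries.C (Q (s n)) * g + PowerSeries.X * (s (n+1)).1 := by
    intro n
    have : s (n+1) = F (s n) := Function.iterate_succ_apply' F n _
    rw [this]; exact hF _
  have key : ∀ N, f = (∑ i ∈ Finset.range N, PowerSeries.C (Q (s i)) * PowerSeries.X ^ i) * g
      + PowerSeries.X ^ N * (s N).1 := by
    intro N
    induction N with
    | zero => simp [s]
    | succ N ih =>
      rw [Finset.sum_range_succ, pow_succ]
      rw [hs N] at ih
      nth_rewrite 1 [ih]; ring
  refine ⟨PowerSeries.mk fun i => Q (s i), ?_⟩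
  ext m
  have h4 : PowerSeries.X ^ (m+1) ∣ f - g * PowerSeries.mk fun i => Q (s i) := by
    have h5 : PowerSeries.X ^ (m+1) ∣ (PowerSeries.mk fun i => Q (s i)) -
        (∑ i ∈ Finset.range (m+1), PowerSeries.C (Q (s i)) * PowerSeries.X ^ i) := by
      rw [PowerSeries.X_pow_dvd_iff]
      intro j hj
      simp [PowerSeries.coeff_C_mul, PowerSeries.coeff_X_pow]
      rw [if_pos (by omega), sub_self]
    obtain ⟨c, hc⟩ := h5
    refine ⟨(s (m+1)).1 - g * c, ?_⟩
    linear_combination key (m+1) - g * hc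
  rw [PowerSeries.X_pow_dvd_iff] at h4
  have := h4 m (by omega)
  rwa [map_sub, sub_eq_zero] at this

theorem exists_X_pow_mul {A : Type*} [CommRing A] [IsDomain A] (f : PowerSeries A) (hf : f ≠ 0) :
    ∃ (n : ℕ) (f' : PowerSeries A), f = PowerSeries.X ^ n * f' ∧
      PowerSeries.constantCoeff f' ≠ 0 := by
  obtain ⟨f', hf'⟩ := PowerSeries.X_pow_order_dvd (φ := f)
  refine ⟨_, f', hf', fun h0 => ?_⟩
  have h1 := (PowerSeries.coeff_order hf)
  have := PowerSeries.coeff_X_pow_mul f' f.order.toNat 0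
  rw [← hf', zero_add] at this
  rw [this] at h1
  exact h1 (by simpa using h0)

theorem CIC.powerSeries {A : Type*} [CommRing A] [IsDomain A] (hA : CIC A) :
    CIC (PowerSeries A) := by
  intro f g h hg hh H
  by_cases hf : f = 0
  · simp [hf]
  obtain ⟨a, f', rfl, hf'⟩ := exists_X_pow_mul f hf
  obtain ⟨b, g', rfl, hg'⟩ := exists_X_pow_mul g hg
  obtain ⟨c, h', rfl, hh'⟩ := exists_X_pow_mul h hh
  have hp := (PowerSeries.X_prime (R := A))
  have nd : ∀ u : PowerSeries A, PowerSeries.constantCoeff u ≠ 0 → ¬ PowerSeries.X ∣ u :=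
    fun u hu => by rwa [PowerSeries.X_dvd_iff]
  have e : ∀ n, PowerSeries.X ^ c * h' * (PowerSeries.X ^ a * f') ^ n
      = PowerSeries.X ^ (c + a * n) * (h' * f' ^ n) := by
    intro n; rw [mul_pow, pow_add, pow_mul]; ring
  simp only [e] at H
  simp only [mul_pow] at H
  have hab : b ≤ a := by
    have h1 := (dvd_mul_right _ _).trans (H (c+1))
    rw [← pow_mul] at h1
    have h2 := hp.pow_dvd_of_dvd_mul_right _ (nd (h' * f' ^ (c+1)) (by simp [hf', hh'])) h1
    rw [pow_dvd_pow_iff hp.ne_zero hp.not_isUnit] at h2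
    by_contra hlt
    push Not at hlt
    nlinarith
  refine mul_dvd_mul (pow_dvd_pow _ hab) (CIC.aux hA f' g' h' hg' hh' fun n => ?_)
  obtain ⟨w, hw⟩ := (dvd_mul_left _ _).trans (H n)
  have h2 : PowerSeries.X ^ (c + a * n) ∣ g' ^ n * w := ⟨_, hw.symm⟩
  obtain ⟨v, rfl⟩ := hp.pow_dvd_of_dvd_mul_left _ (nd (g' ^ n) (by simp [hg'])) h2
  refine ⟨v, mul_left_cancel₀ (pow_ne_zero (c + a * n) hp.ne_zero) ?_⟩
  rw [hw]; ring

theorem CIC.mvPowerSeries (k : Type*) [Field k] (n : ℕ) : CIC (MvPowerSeries (Fin n) k) := by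
  induction n with
  | zero => exact CIC.of_equiv (MvPowerSeries.isEmptyEquiv (Fin 0) k).symm.toRingEquiv (CIC.of_field k)
  | succ n ih => 
    have : IsDomain (MvPowerSeries (Fin n) k) := NoZeroDivisors.to_isDomain _
    exact CIC.of_equiv (MvPowerSeries.finSuccEquiv k n).symm.toRingEquiv ih.powerSeries

theorem CIC.isIntegrallyClosed {A : Type*} [CommRing A] [IsDomain A] (hA : CIC A) :
    IsIntegrallyClosed A := by
  rw [isIntegrallyClosed_iff (FractionRing A)]
  intro x hx
  obtain ⟨h, hh, H⟩ := FractionalIdeal.isFractional_of_fg (S := nonZeroDivisors A) hx.fg_adjoin_singleton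
  obtain ⟨f, g, hg, rfl⟩ := IsFractionRing.div_surjective (A := A) x
  have hg0 : algebraMap A (FractionRing A) g ≠ 0 := by
    simpa using nonZeroDivisors.ne_zero hg
  obtain ⟨q, rfl⟩ := hA f g h (nonZeroDivisors.ne_zero hg) (nonZeroDivisors.ne_zero hh) (fun n => by
    obtain ⟨w, hw⟩ := H _ (Subalgebra.pow_mem _ (Algebra.self_mem_adjoin_singleton A _) n)
    refine ⟨w, IsFractionRing.injective A (FractionRing A) ?_⟩
    rw [Algebra.smul_def, div_pow] at hw
    simp only [map_mul, map_pow, hw]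
    field_simp)
  exact ⟨q, by rw [map_mul]; field_simp⟩

section
variable {k S : Type*} [Field k] [CommRing S] [Algebra k S]

theorem mem_adjoin_ideal_iff (J : Ideal S) (x : S) :
    x ∈ Algebra.adjoin k (J : Set S) ↔ ∃ c : k, x - algebraMap k S c ∈ J := by
  constructor
  · intro hx
    induction hx using Algebra.adjoin_induction with
    | mem x hx => exact ⟨0, by simpa using hx⟩
    | algebraMap r => exact ⟨r, by simp⟩
    | add x y _ _ hx hy =>
      obtain ⟨a, ha⟩ := hx
      obtain ⟨b, hb⟩ := hy
      refine ⟨a + b, ?_⟩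
      have := J.add_mem ha hb
      rw [map_add]; convert this using 1; ring
    | mul x y _ _ hx hy =>
      obtain ⟨a, ha⟩ := hx
      obtain ⟨b, hb⟩ := hy
      refine ⟨a * b, ?_⟩
      have := J.add_mem (J.mul_mem_right y ha) (J.mul_mem_left (algebraMap k S a) hb)
      rw [map_mul]; convert this using 1; ring
  · rintro ⟨c, hc⟩
    have := add_mem (Algebra.subset_adjoin (R := k) hc)
      (Subalgebra.algebraMap_mem (Algebra.adjoin k (J : Set S)) c)
    simpa using this

theorem exists_fg_complement [IsNoetherianRing S] (n : Ideal S)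
    (hn : ∀ s : S, ∃ c : k, s - algebraMap k S c ∈ n) (I : Ideal S) (m : ℕ) :
    ∃ V : Submodule k S, V.FG ∧ ∀ x ∈ I, ∃ v ∈ V, x - v ∈ n ^ m * I := by
  induction m with
  | zero => exact ⟨⊥, Submodule.fg_bot, fun x hx => ⟨0, by simp, by simpa using hx⟩⟩
  | succ m ih =>
    obtain ⟨V, hV, H⟩ := ih
    obtain ⟨T, hT⟩ := IsNoetherian.noetherian (n ^ m * I)
    refine ⟨V ⊔ Submodule.span k (T : Set S), hV.sup (Submodule.fg_span T.finite_toSet), ?_⟩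
    have key : ∀ y ∈ n ^ m * I, ∃ v ∈ Submodule.span k (T : Set S), y - v ∈ n ^ (m+1) * I := by
      intro y hy
      have hy0 := hy
      rw [← hT] at hy
      induction hy using Submodule.span_induction with
      | mem x hx => exact ⟨x, Submodule.subset_span hx, by simp⟩
      | zero => exact ⟨0, by simp, by simp⟩
      | add x y hx' hy' hx hy =>
        obtain ⟨a, ha, ha'⟩ := hx (hT ▸ hx')
        obtain ⟨b, hb, hb'⟩ := hy (hT ▸ hy')
        refine ⟨a + b, add_mem ha hb, ?_⟩
        convert Ideal.add_mem _ ha' hb' using 1; ring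
      | smul s x hx' hx =>
        have hx1 : x ∈ n ^ m * I := hT ▸ hx'
        obtain ⟨a, ha, ha'⟩ := hx hx1
        obtain ⟨c, hc⟩ := hn s
        refine ⟨c • a, Submodule.smul_mem _ _ ha, ?_⟩
        have h1 : (s - algebraMap k S c) * x ∈ n ^ (m+1) * I := by
          rw [pow_succ', mul_assoc]; exact Ideal.mul_mem_mul hc hx1
        convert Ideal.add_mem _ h1 (Ideal.mul_mem_left _ (algebraMap k S c) ha') using 1
        rw [smul_eq_mul, Algebra.smul_def c a]; ring
    intro x hx
    obtain ⟨v, hv, hv'⟩ := H x hx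
    obtain ⟨w, hw, hw'⟩ := key _ hv'
    exact ⟨v + w, Submodule.add_mem_sup hv hw, by convert hw' using 1; ring⟩

theorem exists_fg_complement' [IsNoetherianRing S] (n J : Ideal S) (hJn : J.radical = n)
    (hn : ∀ s : S, ∃ c : k, s - algebraMap k S c ∈ n) (I : Ideal S) :
    ∃ V : Submodule k S, V.FG ∧ ∀ x ∈ I, ∃ v ∈ V, x - v ∈ J * I := by
  obtain ⟨m, hm⟩ := J.exists_radical_pow_le_of_fg (IsNoetherian.noetherian _)
  rw [hJn] at hm
  obtain ⟨V, hV, H⟩ := exists_fg_complement n hn I m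
  refine ⟨V, hV, fun x hx => ?_⟩
  obtain ⟨v, hv, h⟩ := H x hx
  exact ⟨v, hv, Ideal.mul_mono_left hm h⟩

theorem span_fg_of_fg (J : Ideal S) {V : Submodule k S} (hV : V.FG) :
    (Submodule.span (Algebra.adjoin k (J : Set S)) (V : Set S)).FG := by
  obtain ⟨T, rfl⟩ := hV
  rw [Submodule.span_span_of_tower]
  exact Submodule.fg_span T.finite_toSet

theorem finite_over_adjoin [IsNoetherianRing S] (n J : Ideal S) (hJn : J.radical = n)
    (hn : ∀ s : S, ∃ c : k, s - algebraMap k S c ∈ n) :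
    Module.Finite (Algebra.adjoin k (J : Set S)) S := by
  obtain ⟨V, hV, H⟩ := exists_fg_complement' n J hJn hn ⊤
  refine ⟨?_⟩
  have : (⊤ : Submodule (Algebra.adjoin k (J : Set S)) S) =
      Submodule.span (Algebra.adjoin k (J : Set S)) (V : Set S) ⊔
      Submodule.span (Algebra.adjoin k (J : Set S)) {1} := by
    symm; rw [eq_top_iff]
    intro x _
    obtain ⟨v, hv, h⟩ := H x trivial
    have h2 : x - v ∈ J := by simpa using h
    have h3 : x = v + (⟨x - v, Algebra.subset_adjoin h2⟩ : Algebra.adjoin k (J : Set S)) • (1:S) := by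
      rw [Subalgebra.smul_def]; simp
    rw [h3]
    exact Submodule.add_mem_sup (Submodule.subset_span hv)
      (Submodule.smul_mem _ _ (Submodule.subset_span rfl))
  rw [this]
  exact (span_fg_of_fg J hV).sup (Submodule.fg_span (Set.finite_singleton _))

theorem noetherian_over_adjoin [IsNoetherianRing S] (n J : Ideal S) (hJn : J.radical = n)
    (hn : ∀ s : S, ∃ c : k, s - algebraMap k S c ∈ n) :
    IsNoetherian (Algebra.adjoin k (J : Set S)) S := by
  have hfin := finite_over_adjoin n J hJn hn
  refine ⟨fun N => ?_⟩
  obtain ⟨V, hV, H⟩ := exists_fg_complement' n J hJn hn (Ideal.span (N : Set S))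
  have hle : ∀ x ∈ J * Ideal.span (N : Set S), x ∈ N := by
    intro x hx
    induction hx using Submodule.mul_induction_on' with
    | mem_mul_mem j hj y hy =>
      induction hy using Submodule.span_induction generalizing j with
      | mem x hx =>
        exact N.smul_mem (⟨j, Algebra.subset_adjoin hj⟩ : Algebra.adjoin k (J : Set S)) hx
      | zero => simp
      | add x y _ _ hx hy => rw [mul_add]; exact add_mem (hx j hj) (hy j hj)
      | smul s x _ hx =>
        have := hx (j * s) (J.mul_mem_right s hj)
        rwa [smul_eq_mul, ← mul_assoc]
    | add x _ y _ hx hy => exact add_mem hx hy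
  have hW : (V ⊓ N.restrictScalars k).FG := by
    have : IsNoetherian k V := isNoetherian_of_fg_of_noetherian V hV
    exact Submodule.FG.of_le hV inf_le_left
  have hI : ((J * Ideal.span (N : Set S)).restrictScalars (Algebra.adjoin k (J : Set S))).FG := by
    have h1 : Module.Finite S (J * Ideal.span (N : Set S) : Ideal S) :=
      Module.Finite.iff_fg.mpr (IsNoetherian.noetherian _)
    have h2 : Module.Finite (Algebra.adjoin k (J : Set S)) (J * Ideal.span (N : Set S) : Ideal S) :=
      Module.Finite.trans S _
    exact Module.Finite.iff_fg.mp h2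
  have : N = Submodule.span (Algebra.adjoin k (J : Set S)) ((V ⊓ N.restrictScalars k : Submodule k S) : Set S) ⊔
      (J * Ideal.span (N : Set S)).restrictScalars (Algebra.adjoin k (J : Set S)) := by
    apply le_antisymm
    · intro x hx
      obtain ⟨v, hv, h⟩ := H x (Ideal.subset_span hx)
      have hvN : v ∈ N := by
        have := N.sub_mem hx (hle _ h)
        simpa using this
      rw [show x = v + (x - v) by ring]
      exact Submodule.add_mem_sup (Submodule.subset_span ⟨hv, hvN⟩) h
    · refine sup_le (Submodule.span_le.mpr fun x hx => hx.2) hle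
  rw [this]
  exact (span_fg_of_fg J hW).sup hI

theorem noetherianRing_adjoin [IsNoetherianRing S] (n J : Ideal S) (hJn : J.radical = n)
    (hn : ∀ s : S, ∃ c : k, s - algebraMap k S c ∈ n) :
    IsNoetherianRing (Algebra.adjoin k (J : Set S)) := by
  have := noetherian_over_adjoin n J hJn hn
  exact isNoetherian_of_injective (Algebra.linearMap (Algebra.adjoin k (J : Set S)) S)
    Subtype.val_injective

theorem isUnit_adjoin_iff [IsLocalRing S] (J : Ideal S)
    (hJn : J.radical = IsLocalRing.maximalIdeal S) (x : Algebra.adjoin k (J : Set S)) :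
    IsUnit x ↔ (x : S) ∉ J := by
  have hle : J ≤ IsLocalRing.maximalIdeal S := hJn ▸ Ideal.le_radical
  constructor
  · intro hx hJ
    have h1 : IsUnit (x : S) := hx.map (Algebra.adjoin k (J : Set S)).val
    exact (IsLocalRing.mem_maximalIdeal _).mp (hle hJ) h1
  · intro hx
    obtain ⟨c, hc⟩ := (mem_adjoin_ideal_iff J (x : S)).mp x.2
    have hc0 : c ≠ 0 := by
      rintro rfl
      exact hx (by simpa using hc)
    have hxu : IsUnit (x : S) := by
      by_contra hnu
      have h1 : (x : S) ∈ IsLocalRing.maximalIdeal S := (IsLocalRing.mem_maximalIdeal _).mpr hnu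
      have h2 := Ideal.sub_mem _ h1 (hle hc)
      rw [sub_sub_cancel] at h2
      exact (IsLocalRing.mem_maximalIdeal _).mp h2 ((IsUnit.mk0 c hc0).map (algebraMap k S))
    obtain ⟨y, hy⟩ := hxu.exists_right_inv
    have hyR : y ∈ Algebra.adjoin k (J : Set S) := by
      rw [mem_adjoin_ideal_iff]
      refine ⟨c⁻¹, ?_⟩
      have hcc : algebraMap k S c * algebraMap k S c⁻¹ = 1 := by
        rw [← map_mul, mul_inv_cancel₀ hc0, map_one]
      have := J.mul_mem_left (- algebraMap k S c⁻¹ * y) hc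
      convert this using 1
      linear_combination (-y) * hcc + (algebraMap k S c⁻¹) * hy
    exact IsUnit.of_mul_eq_one (⟨y, hyR⟩ : Algebra.adjoin k (J : Set S)) (Subtype.ext hy)

theorem isLocalRing_adjoin [IsLocalRing S] (J : Ideal S)
    (hJn : J.radical = IsLocalRing.maximalIdeal S) :
    IsLocalRing (Algebra.adjoin k (J : Set S)) := by
  have : Nontrivial (Algebra.adjoin k (J : Set S)) := inferInstance
  refine IsLocalRing.of_nonunits_add ?_
  intro a b ha hb
  rw [mem_nonunits_iff, isUnit_adjoin_iff J hJn, not_not] at *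
  exact J.add_mem ha hb

theorem frac_of_conductor {R S : Type*} [CommRing R] [CommRing S] [Algebra R S] [IsDomain S]
    (hRS : Function.Injective (algebraMap R S)) (J : Ideal S) (hJ : J ≠ ⊥)
    (hJR : ∀ j ∈ J, ∃ r : R, algebraMap R S r = j) (K : Type*) [Field K] [Algebra S K]
    [IsFractionRing S K] [Algebra R K] [IsScalarTower R S K] :
    IsFractionRing R K := by
  have hmap : ∀ r : R, algebraMap R K r = algebraMap S K (algebraMap R S r) := fun r =>
    IsScalarTower.algebraMap_apply R S K r
  have hinj : Function.Injective (algebraMap R K) := by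
    intro a b hab
    rw [hmap, hmap] at hab
    exact hRS (IsFractionRing.injective S K hab)
  have : FaithfulSMul R K := (faithfulSMul_iff_algebraMap_injective _ _).mpr hinj
  obtain ⟨j, hj, hj0⟩ := Submodule.exists_mem_ne_zero_of_ne_bot hJ
  refine IsFractionRing.of_field _ _ fun z => ?_
  obtain ⟨a, b, hb, rfl⟩ := IsFractionRing.div_surjective (A := S) z
  obtain ⟨a', ha'⟩ := hJR (j * a) (J.mul_mem_right _ hj)
  obtain ⟨b', hb'⟩ := hJR (j * b) (J.mul_mem_right _ hj)
  refine ⟨a', b', ?_⟩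
  rw [hmap, hmap, ha', hb']
  have h1 : algebraMap S K j ≠ 0 := by simpa using hj0
  have h2 : algebraMap S K b ≠ 0 := by simpa using nonZeroDivisors.ne_zero hb
  simp only [map_mul]
  field_simp

theorem integralClosure_of_finite {R S : Type*} [CommRing R] [CommRing S] [Algebra R S]
    [Module.Finite R S] [IsDomain S] [IsIntegrallyClosed S]
    (K : Type*) [Field K] [Algebra S K] [IsFractionRing S K] [Algebra R K] [IsScalarTower R S K] :
    (integralClosure R K : Set K) = Set.range (algebraMap S K) := by
  ext z
  constructor
  · intro hz
    have hz' : IsIntegral R z := hz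
    exact IsIntegrallyClosed.isIntegral_iff.mp (hz'.tower_top (A := S))
  · rintro ⟨s, rfl⟩
    have : IsIntegral R s := Algebra.IsIntegral.isIntegral s
    exact this.algebraMap

theorem weaklyArf_adjoin [IsNoetherianRing S] [IsDomain S] [IsLocalRing S] [IsIntegrallyClosed S]
    (J : Ideal S) (hJn : J.radical = IsLocalRing.maximalIdeal S) (hJ : J ≠ ⊥)
    (hn : ∀ s : S, ∃ c : k, s - algebraMap k S c ∈ IsLocalRing.maximalIdeal S) :
    IsWeaklyArf (Algebra.adjoin k (J : Set S)) := by
  intro x y z hx hu hv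
  have hfin := finite_over_adjoin (k := k) _ J hJn hn
  have hfrac := frac_of_conductor (R := Algebra.adjoin k (J : Set S)) Subtype.val_injective J hJ
    (fun j hj => ⟨⟨j, Algebra.subset_adjoin hj⟩, rfl⟩) (FractionRing S)
  let e := FractionRing.algEquiv (Algebra.adjoin k (J : Set S)) (FractionRing S)
  have hinj := IsFractionRing.injective (Algebra.adjoin k (J : Set S))
    (FractionRing (Algebra.adjoin k (J : Set S)))
  have key : ∀ y : Algebra.adjoin k (J : Set S),
      (∃ u ∈ integralClosure (Algebra.adjoin k (J : Set S))
          (FractionRing (Algebra.adjoin k (J : Set S))),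
        u * algebraMap _ (FractionRing (Algebra.adjoin k (J : Set S))) x = algebraMap _ _ y) →
      ∃ s : S, s * x = y := by
    rintro y ⟨u, hu, h⟩
    have hu' : IsIntegral (Algebra.adjoin k (J : Set S)) u := hu
    have h1 : e u ∈ (integralClosure (Algebra.adjoin k (J : Set S)) (FractionRing S) : Set _) :=
      hu'.map e
    rw [integralClosure_of_finite (S := S)] at h1
    obtain ⟨s, hs⟩ := h1
    refine ⟨s, IsFractionRing.injective S (FractionRing S) ?_⟩
    have h2 := congrArg e h
    rw [map_mul, e.commutes, e.commutes, ← hs,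
      IsScalarTower.algebraMap_apply (Algebra.adjoin k (J : Set S)) S (FractionRing S) x,
      IsScalarTower.algebraMap_apply (Algebra.adjoin k (J : Set S)) S (FractionRing S) y] at h2
    rw [map_mul]; exact h2
  obtain ⟨s, hs⟩ := key y hu
  obtain ⟨t, ht⟩ := key z hv
  suffices h : ∃ r : Algebra.adjoin k (J : Set S), r * x = y * z by
    obtain ⟨r, hr⟩ := h
    exact ⟨r, by rw [← map_mul, hr]⟩
  by_cases hxJ : (x : S) ∈ J
  · refine ⟨⟨s * t * x, Algebra.subset_adjoin (J.mul_mem_left _ hxJ)⟩, Subtype.ext ?_⟩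
    change s * t * x * x = y * z
    rw [← hs, ← ht]; ring
  · obtain ⟨w, hw⟩ := ((isUnit_adjoin_iff J hJn x).mpr hxJ).exists_right_inv
    exact ⟨y * z * w, by rw [mul_assoc, mul_comm w x, hw, mul_one]⟩
end

set_option synthInstance.maxHeartbeats 1000000 in
set_option maxHeartbeats 1000000 in
/-- Let `S = k[[X₁, …, X_d]]` (`d > 0`) be the formal power series ring over
a field `k` with maximal ideal `𝔫`, let `J` be any `𝔫`-primary ideal of `S` (i.e.
`√J = 𝔫`), and set `R = k + J ⊆ S` (the `k`-subalgebra generated by `J`).  Then `R` is a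
Noetherian local ring with maximal ideal `J`, the fraction field of `S` is a fraction field
of `R` in which the integral closure of `R` is `S`, and `R` is a weakly Arf ring. -/
theorem k_plus_primary_ideal_weaklyArf
    (k : Type*) [Field k] (d : ℕ) (hd : 0 < d)
    (J : Ideal (MvPowerSeries (Fin d) k))
    (hJ : J.radical = IsLocalRing.maximalIdeal (MvPowerSeries (Fin d) k))
    (K : Type*) [Field K] [Algebra (MvPowerSeries (Fin d) k) K]
    [IsFractionRing (MvPowerSeries (Fin d) k) K] :
    IsNoetherianRing (Algebra.adjoin k (J : Set (MvPowerSeries (Fin d) k))) ∧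
    IsLocalRing (Algebra.adjoin k (J : Set (MvPowerSeries (Fin d) k))) ∧
    (∀ [IsLocalRing (Algebra.adjoin k (J : Set (MvPowerSeries (Fin d) k)))]
        (x : Algebra.adjoin k (J : Set (MvPowerSeries (Fin d) k))),
      x ∈ IsLocalRing.maximalIdeal (Algebra.adjoin k (J : Set (MvPowerSeries (Fin d) k)))
        ↔ (x : MvPowerSeries (Fin d) k) ∈ J) ∧
    (letI : Algebra (Algebra.adjoin k (J : Set (MvPowerSeries (Fin d) k))) K :=
      ((algebraMap (MvPowerSeries (Fin d) k) K).comp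
        (Algebra.adjoin k (J : Set (MvPowerSeries (Fin d) k))).val.toRingHom).toAlgebra
     IsFractionRing (Algebra.adjoin k (J : Set (MvPowerSeries (Fin d) k))) K ∧
       (integralClosure (Algebra.adjoin k (J : Set (MvPowerSeries (Fin d) k))) K : Set K)
         = Set.range (algebraMap (MvPowerSeries (Fin d) k) K)) ∧
    IsWeaklyArf (Algebra.adjoin k (J : Set (MvPowerSeries (Fin d) k))) := by
  have hdom : IsDomain (MvPowerSeries (Fin d) k) := NoZeroDivisors.to_isDomain _
  have hic : IsIntegrallyClosed (MvPowerSeries (Fin d) k) :=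
    (CIC.mvPowerSeries k d).isIntegrallyClosed
  have hn : ∀ s : MvPowerSeries (Fin d) k, ∃ c : k,
      s - algebraMap k (MvPowerSeries (Fin d) k) c ∈
        IsLocalRing.maximalIdeal (MvPowerSeries (Fin d) k) := by
    intro s
    refine ⟨MvPowerSeries.constantCoeff s, ?_⟩
    rw [IsLocalRing.mem_maximalIdeal, mem_nonunits_iff, MvPowerSeries.isUnit_iff_constantCoeff]
    simp [MvPowerSeries.algebraMap_apply]
  have hJ0 : J ≠ ⊥ := by
    rintro rfl
    have hX : (MvPowerSeries.X ⟨0, hd⟩ : MvPowerSeries (Fin d) k) ∈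
        (⊥ : Ideal (MvPowerSeries (Fin d) k)).radical := by
      rw [hJ, IsLocalRing.mem_maximalIdeal, mem_nonunits_iff,
        MvPowerSeries.isUnit_iff_constantCoeff]
      simp
    obtain ⟨m, hm⟩ := hX
    have hX0 : (MvPowerSeries.X ⟨0, hd⟩ : MvPowerSeries (Fin d) k) = 0 :=
      (IsReduced.eq_zero _ ⟨m, by simpa using hm⟩)
    have h1 := MvPowerSeries.coeff_index_single_self_X (R := k) (⟨0, hd⟩ : Fin d)
    rw [hX0] at h1
    simp at h1
  have hfin := finite_over_adjoin (k := k) _ J hJ hn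
  refine ⟨noetherianRing_adjoin _ J hJ hn, isLocalRing_adjoin J hJ, ?_, ?_,
    weaklyArf_adjoin J hJ hJ0 hn⟩
  · intro _ x
    rw [IsLocalRing.mem_maximalIdeal, mem_nonunits_iff, isUnit_adjoin_iff J hJ, not_not]
  · letI : Algebra (Algebra.adjoin k (J : Set (MvPowerSeries (Fin d) k))) K :=
      ((algebraMap (MvPowerSeries (Fin d) k) K).comp
        (Algebra.adjoin k (J : Set (MvPowerSeries (Fin d) k))).val.toRingHom).toAlgebra
    have htow : @IsScalarTower (Algebra.adjoin k (J : Set (MvPowerSeries (Fin d) k)))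
        (MvPowerSeries (Fin d) k) K _ _ this.toSMul :=
      @IsScalarTower.of_algebraMap_eq _ _ _ _ _ _ _ _ this (fun _ => rfl)
    exact ⟨@frac_of_conductor _ _ _ _ _ _ Subtype.val_injective J hJ0
      (fun j hj => ⟨⟨j, Algebra.subset_adjoin hj⟩, rfl⟩) K _ _ _ this htow,
      @integralClosure_of_finite _ _ _ _ _ hfin _ _ K _ _ _ this htow⟩
end

section
/- Let R be a Noetherian ring of prime characteristic p > 0 that is F-pure and satisfies Serre's condition (S₂). Then R is a weakly Arf ring. -/
open scoped TensorProduct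

universe u v

/-- A ring homomorphism `f : R →+* S` is pure if for every `R`-module `M` the base-change
map `M → S ⊗_R M`, `m ↦ 1 ⊗ m` (where `S` is regarded as an `R`-module via `f`), is
injective. -/
def RingHom.IsPureHom {R : Type u} {S : Type v} [CommRing R] [CommRing S] (f : R →+* S) : Prop :=
  ∀ (M : Type u) [AddCommGroup M] [Module R M],
    letI : Algebra R S := f.toAlgebra
    Function.Injective (fun m : M => (1 : S) ⊗ₜ[R] m)

/-- A ring `R` of prime characteristic `p` is `F`-pure if its Frobenius endomorphism
`a ↦ a^p` is a pure ring map. -/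
def IsFPure (R : Type*) [CommRing R] (p : ℕ) [Fact p.Prime] [CharP R p] : Prop :=
  (frobenius R p).IsPureHom

/-- A (Noetherian) ring satisfies Serre's condition `(S₂)` iff for every prime `𝔭` the local
ring `R_𝔭` has depth at least `min(2, dim R_𝔭)`, i.e. admits a regular sequence in its
maximal ideal of length at least `min(2, dim R_𝔭)`. -/
def SerreConditionS2 (R : Type*) [CommRing R] : Prop :=
  ∀ (P : Ideal R) [P.IsPrime],
    ∃ s : List (Localization.AtPrime P),
      (∀ a ∈ s, a ∈ IsLocalRing.maximalIdeal (Localization.AtPrime P)) ∧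
      RingTheory.Sequence.IsRegular (Localization.AtPrime P) s ∧
      min 2 (ringKrullDim (Localization.AtPrime P)) ≤ (s.length : WithBot ℕ∞)

theorem RingHom.IsPureHom.dvd_of_map_dvd {R : Type u} {S : Type v} [CommRing R] [CommRing S]
    {f : R →+* S} (hf : f.IsPureHom) {x a : R} (h : f x ∣ f a) : x ∣ a := by
  letI : Algebra R S := f.toAlgebra
  have hinj := hf (R ⧸ Ideal.span {x})
  obtain ⟨r, hr⟩ := h
  have hsm : ∀ c : R, (1 : S) ⊗ₜ[R] (Ideal.Quotient.mk (Ideal.span {x}) c)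
      = (f c) ⊗ₜ[R] (1 : R ⧸ Ideal.span {x}) := by
    intro c
    have h1 : Ideal.Quotient.mk (Ideal.span {x}) c = c • (1 : R ⧸ Ideal.span {x}) := by
      rw [Algebra.smul_def, mul_one]; rfl
    rw [h1, ← TensorProduct.smul_tmul, Algebra.smul_def, mul_one]; rfl
  have hx0 : Ideal.Quotient.mk (Ideal.span {x}) x = 0 :=
    Ideal.Quotient.eq_zero_iff_mem.2 (Ideal.mem_span_singleton_self x)
  have h0 : (f x) ⊗ₜ[R] (1 : R ⧸ Ideal.span {x}) = 0 := by
    rw [← hsm, hx0, TensorProduct.tmul_zero]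
  have ha : (f a) ⊗ₜ[R] (1 : R ⧸ Ideal.span {x}) = 0 := by
    have h2 := congrArg (fun t => r • t) h0
    simp only [smul_zero, TensorProduct.smul_tmul', smul_eq_mul] at h2
    rw [hr, mul_comm]; exact h2
  have h3 : Ideal.Quotient.mk (Ideal.span {x}) a = 0 := by
    apply hinj
    simp only
    rw [hsm, ha, TensorProduct.tmul_zero]
  exact Ideal.mem_span_singleton.1 (Ideal.Quotient.eq_zero_iff_mem.1 h3)

/-- A single power of the denominator clears all powers of an integral element. -/
theorem exists_pow_mul_pow_mem {R K : Type*} [CommRing R] [CommRing K] [Algebra R K]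
    (x : R) (b : K) (hb : IsIntegral R b) (hx : ∃ c : R, algebraMap R K c = algebraMap R K x * b) :
    ∃ N : ℕ, ∀ n : ℕ, ∃ c : R, algebraMap R K c = algebraMap R K x ^ N * b ^ n := by
  obtain ⟨c, hc⟩ := hx
  obtain ⟨q, hq, hq0⟩ := hb
  refine ⟨q.natDegree, fun n => ?_⟩
  have key : b ^ n = Polynomial.aeval b ((Polynomial.X : Polynomial R) ^ n %ₘ q) := by
    have h := Polynomial.modByMonic_add_div ((Polynomial.X : Polynomial R) ^ n) q
    have h' := congrArg (Polynomial.aeval b) h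
    have hq0' : Polynomial.aeval b q = 0 := hq0
    simp only [map_add, map_mul, hq0', zero_mul, add_zero, map_pow, Polynomial.aeval_X] at h'
    exact h'.symm
  set g := (Polynomial.X : Polynomial R) ^ n %ₘ q with hg
  have hdeg : g.natDegree ≤ q.natDegree := by
    exact Polynomial.natDegree_modByMonic_le _ hq
  refine ⟨∑ i ∈ Finset.range (q.natDegree + 1), g.coeff i * (c ^ i * x ^ (q.natDegree - i)), ?_⟩
  rw [key, Polynomial.aeval_eq_sum_range' (Nat.lt_succ_of_le hdeg), map_sum, Finset.mul_sum]
  refine Finset.sum_congr rfl fun i hi => ?_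
  have hi' : i ≤ q.natDegree := Nat.lt_succ_iff.1 (Finset.mem_range.1 hi)
  obtain ⟨j, hj⟩ := Nat.exists_eq_add_of_le hi'
  rw [Algebra.smul_def]
  simp only [map_mul, map_pow, hc]
  rw [hj, Nat.add_sub_cancel_left]
  ring

theorem isWeaklyArf_of_fPure_of_S2
    (R : Type*) [CommRing R] [IsNoetherianRing R]
    (p : ℕ) [Fact p.Prime] [CharP R p]
    (hFpure : IsFPure R p) (hS2 : SerreConditionS2 R) :
    IsWeaklyArf R := by
  intro x y z hx ⟨s, hs, hsy⟩ ⟨t, ht, htz⟩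
  have hinj : Function.Injective (algebraMap R (FractionRing R)) :=
    IsFractionRing.injective R (FractionRing R)
  have hp : p.Prime := Fact.out
  obtain ⟨N, hN⟩ := exists_pow_mul_pow_mem (K := FractionRing R) (x ^ 2) (s * t)
    (IsIntegral.mul hs ht) ⟨y * z, by rw [map_mul, ← hsy, ← htz, map_pow]; ring⟩
  -- p-closedness
  have hcl : ∀ e : ℕ, x ^ p ^ e ∣ (y * z) ^ p ^ e → x ∣ y * z := by
    intro e
    induction e with
    | zero => simp
    | succ e ih =>
      intro h
      apply ih
      apply RingHom.IsPureHom.dvd_of_map_dvd hFpure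
      rw [frobenius_def, frobenius_def, ← pow_mul, ← pow_mul, ← pow_succ]
      exact h
  have hdvd : x ^ p ^ (2 * N) ∣ (y * z) ^ p ^ (2 * N) := by
    have hle : 2 * N ≤ p ^ (2 * N) := (Nat.lt_pow_self hp.one_lt).le
    obtain ⟨k, hk⟩ := Nat.exists_eq_add_of_le hle
    obtain ⟨c, hc⟩ := hN (p ^ (2 * N))
    refine ⟨c * x ^ k, hinj ?_⟩
    simp only [map_mul, map_pow, hc, ← hsy, ← htz]
    generalize p ^ (2 * N) = m at *
    subst hk
    ring
  obtain ⟨r, hr⟩ := hcl _ hdvd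
  exact ⟨r, by rw [hr, map_mul, mul_comm]⟩
end
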